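/- arXiv:2210.11626 — 2 statements merged into one kernel-verified Lean document; each statement's English description precedes it below -/
import Mathlib

section
/- Let γ₀ > γ > 1/2, σ > 0, and k ∈ ℕ₀. Let (ψ_j)_{j≥1} be the Fourier basis on [0,1] and define the kernel K_γ(x,x') = ∑_{i=1}^∞ e^{-2γi} ψ_i(x) ψ_i(x') (the series and all its term-by-term partial derivatives converge uniformly, so K_γ is smooth). Let f₀ = ∑_{i=1}^∞ f_i ψ_i with ∑_{i=1}^∞ e^{γ₀ i} |f_i| < ∞. For each n, let X₁,…,Xₙ be i.i.d. Uniform[0,1], let ε₁,…,εₙ be i.i.d. N(0, σ²) independent of the X's, and set Y_i = f₀(X_i) + ε_i. With λ_n = 1/n, define the kernel ridge/posterior-mean estimator f̂_n(x) = ∑_{i=1}^n w_i K_γ(x, X_i) where w = (K_γ(X,X) + nλ_n I_n)^{-1} Y and K_γ(X,X) = (K_γ(X_i, X_j))_{i,j=1}^n. Then there exist a constant C > 0 and N ∈ ℕ such that for all n ≥ N, with probability at least 1 − n^{-10} over the data, (∫_0^1 (f̂_n^{(k)}(x) − f₀^{(k)}(x))² dx)^{1/2} ≤ C (log n)^{k+1}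 / √n. -/
open MeasureTheory ProbabilityTheory Real Matrix

/-- The Fourier basis on `[0,1]`: `ψ₁ = 1`, `ψ_{2i}(x) = √2 cos(2πix)`,
`ψ_{2i+1}(x) = √2 sin(2πix)` for `i ≥ 1` (viewed as functions on `ℝ`). -/
noncomputable def fourierPsi (j : ℕ) (x : ℝ) : ℝ :=
  if j = 1 then 1
  else if j % 2 = 0 then Real.sqrt 2 * Real.cos (2 * Real.pi * (j / 2 : ℕ) * x)
  else Real.sqrt 2 * Real.sin (2 * Real.pi * (j / 2 : ℕ) * x)

/-- The kernel with exponentially decaying eigenvalues `μ_i = e^{-2γi}` relative to the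
Fourier basis: `K_γ(x, x') = ∑ e^{-2γi} ψ_i(x) ψ_i(x')`. -/
noncomputable def expKernel (γ : ℝ) (x y : ℝ) : ℝ :=
  ∑' i : ℕ, Real.exp (-2 * γ * ((i : ℝ) + 1)) * fourierPsi (i + 1) x * fourierPsi (i + 1) y

/-- The function with coefficients `f` in the Fourier basis: `∑ f_i ψ_i`. -/
noncomputable def fourierFun (f : ℕ → ℝ) (x : ℝ) : ℝ :=
  ∑' i : ℕ, f i * fourierPsi (i + 1) x

/-- The law of `n` i.i.d. data points `(X_i, ε_i)` with `X_i ~ Uniform[0,1]` and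
`ε_i ~ N(0, σ²)` independent: the `n`-fold product measure on `(ℝ × ℝ)ⁿ`. -/
noncomputable def regressionData (σ : ℝ) (n : ℕ) : Measure (Fin n → ℝ × ℝ) :=
  Measure.pi fun _ =>
    (volume.restrict (Set.Icc (0 : ℝ) 1)).prod (gaussianReal 0 (Real.toNNReal (σ ^ 2)))

/-- The kernel ridge / GP posterior-mean estimator
`f̂_n(x) = ∑_i w_i K(x, X_i)` with `w = (K(X,X) + nλ Iₙ)⁻¹ Y`, where `X_i = (ω i).1`,
`Y_i = f₀(X_i) + ε_i` and `ε_i = (ω i).2`. -/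
noncomputable def krrEstimator (K : ℝ → ℝ → ℝ) (f₀ : ℝ → ℝ) (n : ℕ) (lam : ℝ)
    (ω : Fin n → ℝ × ℝ) (x : ℝ) : ℝ :=
  ∑ i : Fin n,
    (((Matrix.of fun (i j : Fin n) => K (ω i).1 (ω j).1) +
        ((n : ℝ) * lam) • (1 : Matrix (Fin n) (Fin n) ℝ))⁻¹ *ᵥ
      (fun j : Fin n => f₀ (ω j).1 + (ω j).2)) i * K x (ω i).1



/-- amplitude -/
noncomputable def krrAmp (i : ℕ) : ℝ := if i = 0 then 1 else Real.sqrt 2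
/-- phase -/
noncomputable def krrPh (i : ℕ) : ℝ := if i % 2 = 0 ∧ i ≠ 0 then -(Real.pi / 2) else 0
/-- angular frequency -/
noncomputable def krrFr (i : ℕ) : ℝ := 2 * Real.pi * ((i + 1) / 2 : ℕ)
/-- derivative of order `k` of the `i`-th basis function -/
noncomputable def krrD (k i : ℕ) (x : ℝ) : ℝ :=
  krrAmp i * krrFr i ^ k * Real.cos (krrFr i * x + (krrPh i + k * (Real.pi / 2)))

lemma krrFr_nonneg (i : ℕ) : 0 ≤ krrFr i := by unfold krrFr; positivity

lemma krrFr_le (i : ℕ) : krrFr i ≤ 4 * ((i : ℝ) + 1) := by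
  unfold krrFr
  have h : (((i + 1) / 2 : ℕ) : ℝ) ≤ ((i + 1 : ℕ) : ℝ) / 2 := Nat.cast_div_le
  push_cast at h
  have := Real.pi_le_four
  have := Real.pi_pos
  nlinarith

lemma krrAmp_nonneg (i : ℕ) : 0 ≤ krrAmp i := by unfold krrAmp; split_ifs <;> positivity

lemma krrAmp_sq_le (i : ℕ) : krrAmp i ^ 2 ≤ 2 := by unfold krrAmp; split_ifs <;> norm_num

lemma fourierPsi_eq (i : ℕ) (x : ℝ) : fourierPsi (i + 1) x = krrD 0 i x := by
  unfold fourierPsi krrD krrAmp krrPh krrFr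
  by_cases h0 : i = 0
  · subst h0; simp
  · have h1 : ¬ (i + 1 = 1) := by omega
    rw [if_neg h1, if_neg h0]
    by_cases h2 : i % 2 = 0
    · have h3 : ¬ ((i + 1) % 2 = 0) := by omega
      rw [if_neg h3, if_pos ⟨h2, h0⟩]
      simp [← sub_eq_add_neg, Real.cos_sub_pi_div_two]
    · have h3 : (i + 1) % 2 = 0 := by omega
      rw [if_pos h3, if_neg (by tauto)]
      simp

lemma krrD_contDiff (k i : ℕ) {N : WithTop ℕ∞} : ContDiff ℝ N (krrD k i) := by
  unfold krrD; fun_prop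

lemma krrD_continuous (k i : ℕ) : Continuous (krrD k i) := by
  unfold krrD; fun_prop

lemma krrD_abs_le (k i : ℕ) (x : ℝ) : |krrD k i x| ≤ krrAmp i * krrFr i ^ k := by
  unfold krrD
  rw [abs_mul, abs_of_nonneg (mul_nonneg (krrAmp_nonneg i) (pow_nonneg (krrFr_nonneg i) k))]
  exact mul_le_of_le_one_right (mul_nonneg (krrAmp_nonneg i) (pow_nonneg (krrFr_nonneg i) k))
    (Real.abs_cos_le_one _)

lemma krrD_abs_le' (k i : ℕ) (x : ℝ) : |krrD k i x| ≤ 2 * krrFr i ^ k := by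
  refine (krrD_abs_le k i x).trans ?_
  have := krrAmp_sq_le i
  have h2 : krrAmp i ≤ 2 := by nlinarith [krrAmp_nonneg i]
  exact mul_le_mul_of_nonneg_right h2 (pow_nonneg (krrFr_nonneg i) k)

lemma krrD_sq_le (i : ℕ) (x : ℝ) : krrD 0 i x ^ 2 ≤ 2 := by
  have h := krrD_abs_le 0 i x
  rw [pow_zero, mul_one] at h
  have h2 : |krrD 0 i x| ^ 2 ≤ krrAmp i ^ 2 := pow_le_pow_left₀ (abs_nonneg _) h 2
  rw [sq_abs] at h2
  exact h2.trans (krrAmp_sq_le i)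

lemma krrD_hasDerivAt (k i : ℕ) (x : ℝ) : HasDerivAt (krrD k i) (krrD (k+1) i x) x := by
  unfold krrD
  have h : HasDerivAt (fun x : ℝ => krrFr i * x + (krrPh i + k * (Real.pi / 2))) (krrFr i) x := by
    simpa using ((hasDerivAt_id x).const_mul (krrFr i)).add_const (krrPh i + k * (Real.pi / 2))
  have h2 := (h.cos).const_mul (krrAmp i * krrFr i ^ k)
  refine h2.congr_deriv ?_
  have : krrFr i * x + (krrPh i + ((k+1 : ℕ):ℝ) * (Real.pi / 2)) =
    krrFr i * x + (krrPh i + k * (Real.pi / 2)) + Real.pi / 2 := by push_cast; ring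
  rw [this, Real.cos_add_pi_div_two]
  ring

lemma krrD_iteratedDeriv (k i : ℕ) : iteratedDeriv k (krrD 0 i) = krrD k i := by
  induction k with
  | zero => simp
  | succ k ih =>
    rw [iteratedDeriv_succ, ih]
    funext x
    exact (krrD_hasDerivAt k i x).deriv

lemma krr_int_cos (m : ℤ) (hm : m ≠ 0) (a : ℝ) :
    ∫ x in (0:ℝ)..1, Real.cos (2 * Real.pi * m * x + a) = 0 := by
  have hm' : (2 * Real.pi * (m:ℝ)) ≠ 0 := by
    have : (m:ℝ) ≠ 0 := by exact_mod_cast hm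
    positivity
  rw [intervalIntegral.integral_comp_mul_add (fun y => Real.cos y) hm' a, integral_cos]
  have : 2 * Real.pi * m * 1 + a = a + m * (2 * Real.pi) := by ring
  rw [this, Real.sin_add_int_mul_two_pi]
  simp

lemma krrD_orth (k i l : ℕ) :
    ∫ x in (0:ℝ)..1, krrD k i x * krrD k l x = if i = l then krrFr i ^ (2 * k) else 0 := by
  have hprod : ∀ x, krrD k i x * krrD k l x =
      (krrAmp i * krrFr i ^ k) * (krrAmp l * krrFr l ^ k) / 2 *
      (Real.cos (2 * Real.pi * ((((i+1)/2 : ℕ) : ℤ) - (((l+1)/2 : ℕ) : ℤ) : ℤ) * x + (krrPh i - krrPh l))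
      + Real.cos (2 * Real.pi * ((((i+1)/2 : ℕ) : ℤ) + (((l+1)/2 : ℕ) : ℤ) : ℤ) * x +
        (krrPh i + krrPh l + k * Real.pi))) := by
    intro x
    unfold krrD
    set A := krrFr i * x + (krrPh i + k * (Real.pi / 2)) with hA
    set B := krrFr l * x + (krrPh l + k * (Real.pi / 2)) with hB
    have e1 : (2 * Real.pi * ((((i+1)/2 : ℕ) : ℤ) - (((l+1)/2 : ℕ) : ℤ) : ℤ) * x + (krrPh i - krrPh l)) = A - B := by
      rw [hA, hB]; unfold krrFr; push_cast [-Int.natCast_ediv]; ring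
    have e2 : (2 * Real.pi * ((((i+1)/2 : ℕ) : ℤ) + (((l+1)/2 : ℕ) : ℤ) : ℤ) * x +
        (krrPh i + krrPh l + k * Real.pi)) = A + B := by
      rw [hA, hB]; unfold krrFr; push_cast [-Int.natCast_ediv]; ring
    rw [e1, e2, Real.cos_sub A B, Real.cos_add A B]; ring
  simp_rw [hprod]
  rw [intervalIntegral.integral_const_mul, intervalIntegral.integral_add
    (Continuous.intervalIntegrable (by fun_prop) _ _) (Continuous.intervalIntegrable (by fun_prop) _ _)]
  by_cases hil : i = l
  · subst hil
    rw [if_pos rfl]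
    by_cases h0 : i = 0
    · subst h0
      rcases Nat.eq_zero_or_pos k with hk | hk
      · subst hk; simp [krrAmp, krrFr, krrPh]; norm_num
      · simp [krrFr, hk.ne']
    · rw [krr_int_cos ((((i+1)/2 : ℕ) : ℤ) + (((i+1)/2 : ℕ) : ℤ)) (by omega)]
      simp only [sub_self, Int.cast_zero, mul_zero, zero_mul, add_zero, Real.cos_zero]
      simp only [krrAmp, if_neg h0]
      have := Real.mul_self_sqrt (show (0:ℝ) ≤ 2 by norm_num)
      simp
      calc _ = (Real.sqrt 2 * Real.sqrt 2) / 2 * krrFr i ^ (2*k) := by ring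
        _ = _ := by rw [this]; ring
  · rw [if_neg hil]
    rw [krr_int_cos ((((i+1)/2 : ℕ) : ℤ) + (((l+1)/2 : ℕ) : ℤ)) (by omega)]
    by_cases hm : (i+1)/2 = (l+1)/2
    · have h1 : Real.cos (krrPh i - krrPh l) = 0 := by
        unfold krrPh
        by_cases h2 : i % 2 = 0
        · rw [if_pos ⟨h2, by omega⟩, if_neg (by omega)]; simp
        · rw [if_neg (by omega), if_pos ⟨by omega, by omega⟩]; simp
      simp [hm, h1]
    · rw [krr_int_cos _ (by omega)]; simp


/-- eigenvalues -/
noncomputable def krrMu (γ : ℝ) (i : ℕ) : ℝ := Real.exp (-2 * γ * ((i : ℝ) + 1))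

lemma krrMu_pos (γ : ℝ) (i : ℕ) : 0 < krrMu γ i := Real.exp_pos _

lemma krrMu_le (γ : ℝ) (hγ : 1 / 2 < γ) (i : ℕ) : krrMu γ i ≤ Real.exp (-(i:ℝ)) := by
  unfold krrMu
  apply Real.exp_le_exp.2
  have : (0:ℝ) ≤ i := Nat.cast_nonneg i
  nlinarith

lemma krr_summ_half_pow (k : ℕ) : Summable fun i : ℕ => Real.exp (-(i:ℝ) / 2) * (i:ℝ) ^ k := by
  have := Real.summable_pow_mul_exp_neg_nat_mul k (show (0:ℝ) < 1/2 by norm_num)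
  refine this.congr fun i => ?_
  rw [mul_comm]; congr 2; ring

lemma krr_summ_half_fr (k : ℕ) : Summable fun i : ℕ => Real.exp (-(i:ℝ) / 2) * krrFr i ^ k := by
  have h1 := (krr_summ_half_pow k).comp_injective (add_left_injective 1)
  have h2 := h1.mul_left (Real.exp (1/2) * 4 ^ k)
  refine Summable.of_nonneg_of_le (fun i => by have := krrFr_nonneg i; positivity) (fun i => ?_) h2
  have h3 : krrFr i ^ k ≤ (4 * ((i:ℝ)+1)) ^ k := pow_le_pow_left₀ (krrFr_nonneg i) (krrFr_le i) k
  have h4 : Real.exp (-(i:ℝ) / 2) = Real.exp (1/2) * Real.exp (-((i:ℝ)+1) / 2) := by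
    rw [← Real.exp_add]; congr 1; ring
  calc Real.exp (-(i:ℝ) / 2) * krrFr i ^ k ≤ Real.exp (-(i:ℝ) / 2) * (4 * ((i:ℝ)+1)) ^ k := by gcongr
    _ = _ := by
      rw [h4, mul_pow]; simp only [Function.comp]; push_cast; ring

lemma krr_tail (γ : ℝ) (hγ : 1 / 2 < γ) (n D : ℕ) (hn : 1 ≤ n) (hD : 4 * Real.log n ≤ D)
    (q : ℕ → ℝ) (hq : ∀ i, 0 ≤ q i) (hs : Summable fun i : ℕ => Real.exp (-(i:ℝ) / 2) * q i) :
    Summable (fun i => krrMu γ (i + D) * q (i + D)) ∧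
    ∑' i, krrMu γ (i + D) * q (i + D) ≤ ((n:ℝ) ^ 2)⁻¹ * ∑' i : ℕ, Real.exp (-(i:ℝ) / 2) * q i := by
  have hn' : (0:ℝ) < n := by exact_mod_cast hn
  have key : ∀ i, krrMu γ (i + D) * q (i + D) ≤
      ((n:ℝ) ^ 2)⁻¹ * (Real.exp (-((i + D : ℕ):ℝ) / 2) * q (i + D)) := by
    intro i
    rw [← mul_assoc]
    apply mul_le_mul_of_nonneg_right _ (hq _)
    have h1 : ((n:ℝ) ^ 2)⁻¹ = Real.exp (-(2 * Real.log n)) := by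
      rw [Real.exp_neg, two_mul, Real.exp_add, Real.exp_log hn', sq]
    rw [h1, ← Real.exp_add]
    refine (krrMu_le γ hγ _).trans (Real.exp_le_exp.2 ?_)
    push_cast
    have : (0:ℝ) ≤ i := Nat.cast_nonneg i
    linarith
  have hs1 : Summable fun i : ℕ => Real.exp (-((i + D : ℕ):ℝ) / 2) * q (i + D) :=
    (summable_nat_add_iff D).2 hs
  have hs2 := hs1.mul_left ((n:ℝ) ^ 2)⁻¹
  have hs3 : Summable (fun i => krrMu γ (i + D) * q (i + D)) :=
    Summable.of_nonneg_of_le (fun i => mul_nonneg (krrMu_pos _ _).le (hq _)) key hs2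
  refine ⟨hs3, (hs3.tsum_le_tsum key hs2).trans ?_⟩
  rw [tsum_mul_left]
  apply mul_le_mul_of_nonneg_left _ (by positivity)
  have := hs.sum_add_tsum_nat_add D
  rw [← this]
  have : 0 ≤ ∑ i ∈ Finset.range D, Real.exp (-(i:ℝ) / 2) * q i :=
    Finset.sum_nonneg fun i _ => mul_nonneg (Real.exp_pos _).le (hq _)
  linarith

lemma krr_cs (μ c p : ℕ → ℝ) (hμ : ∀ i, 0 < μ i) (hc : Summable fun i => c i ^ 2 / μ i)
    (hp : Summable fun i => μ i * p i ^ 2) :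
    (Summable fun i => |c i * p i|) ∧
    (∑' i, |c i * p i|) ^ 2 ≤ (∑' i, c i ^ 2 / μ i) * ∑' i, μ i * p i ^ 2 := by
  have hs : Summable fun i => |c i * p i| := by
    refine Summable.of_nonneg_of_le (fun i => abs_nonneg _) (fun i => ?_) (hc.add hp)
    have h := hμ i
    have e1 : c i ^ 2 / μ i = (|c i| / Real.sqrt (μ i)) ^ 2 := by
      rw [div_pow, sq_abs, Real.sq_sqrt h.le]
    have e2 : μ i * p i ^ 2 = (Real.sqrt (μ i) * |p i|) ^ 2 := by
      rw [mul_pow, sq_abs, Real.sq_sqrt h.le]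
    have e3 : |c i * p i| = (|c i| / Real.sqrt (μ i)) * (Real.sqrt (μ i) * |p i|) := by
      have := Real.sqrt_pos.2 h
      rw [abs_mul]; field_simp
    rw [e1, e2, e3]
    nlinarith [sq_nonneg ((|c i| / Real.sqrt (μ i)) - (Real.sqrt (μ i) * |p i|)),
      sq_nonneg ((|c i| / Real.sqrt (μ i)) + (Real.sqrt (μ i) * |p i|))]
  refine ⟨hs, ?_⟩
  have hA : 0 ≤ ∑' i, c i ^ 2 / μ i := tsum_nonneg fun i => div_nonneg (sq_nonneg _) (hμ i).le
  have hB : 0 ≤ ∑' i, μ i * p i ^ 2 := tsum_nonneg fun i => mul_nonneg (hμ i).le (sq_nonneg _)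
  have hle : ∑' i, |c i * p i| ≤ Real.sqrt ((∑' i, c i ^ 2 / μ i) * ∑' i, μ i * p i ^ 2) := by
    apply hs.tsum_le_of_sum_le
    intro s
    apply Real.le_sqrt_of_sq_le
    have h1 : (∑ i ∈ s, |c i * p i|) ^ 2 ≤ (∑ i ∈ s, c i ^ 2 / μ i) * ∑ i ∈ s, μ i * p i ^ 2 := by
      apply Finset.sum_sq_le_sum_mul_sum_of_sq_le_mul
      · intro i _; exact div_nonneg (sq_nonneg _) (hμ i).le
      · intro i _; exact mul_nonneg (hμ i).le (sq_nonneg _)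
      · intro i _
        have := (hμ i).ne'
        rw [sq_abs]; apply le_of_eq; field_simp
    refine h1.trans (mul_le_mul ?_ ?_ ?_ hA)
    · exact hc.sum_le_tsum s fun i _ => div_nonneg (sq_nonneg _) (hμ i).le
    · exact hp.sum_le_tsum s fun i _ => mul_nonneg (hμ i).le (sq_nonneg _)
    · exact Finset.sum_nonneg fun i _ => mul_nonneg (hμ i).le (sq_nonneg _)
  calc _ ≤ (Real.sqrt ((∑' i, c i ^ 2 / μ i) * ∑' i, μ i * p i ^ 2)) ^ 2 :=
        pow_le_pow_left₀ (tsum_nonneg fun i => abs_nonneg _) hle 2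
    _ = _ := Real.sq_sqrt (mul_nonneg hA hB)

/-- tail version of Cauchy-Schwarz -/
lemma krr_cs_tail (μ c p : ℕ → ℝ) (D : ℕ) (hμ : ∀ i, 0 < μ i) (hc : Summable fun i => c i ^ 2 / μ i)
    (hp : Summable fun i => μ (i + D) * p (i + D) ^ 2) :
    (Summable fun i => |c (i + D) * p (i + D)|) ∧
    (∑' i, |c (i + D) * p (i + D)|) ^ 2 ≤
      (∑' i, c i ^ 2 / μ i) * ∑' i, μ (i + D) * p (i + D) ^ 2 := by
  have hc' : Summable fun i => c (i + D) ^ 2 / μ (i + D) :=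
    (summable_nat_add_iff (f := fun i => c i ^ 2 / μ i) D).2 hc
  obtain ⟨h1, h2⟩ := krr_cs (fun i => μ (i + D)) (fun i => c (i + D)) (fun i => p (i + D))
    (fun i => hμ _) hc' hp
  refine ⟨h1, h2.trans ?_⟩
  apply mul_le_mul_of_nonneg_right _
    (tsum_nonneg fun i => mul_nonneg (hμ _).le (sq_nonneg _))
  have := hc.sum_add_tsum_nat_add D
  rw [← this]
  have : 0 ≤ ∑ i ∈ Finset.range D, c i ^ 2 / μ i :=
    Finset.sum_nonneg fun i _ => div_nonneg (sq_nonneg _) (hμ i).le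
  linarith

lemma krr_summ_mu (γ : ℝ) (hγ : 1 / 2 < γ) (k : ℕ) :
    Summable fun i => krrMu γ i * krrFr i ^ k := by
  have := (krr_tail γ hγ 1 0 le_rfl (by simp) (fun i => krrFr i ^ k)
    (fun i => pow_nonneg (krrFr_nonneg i) k) (krr_summ_half_fr k)).1
  simpa using this

lemma krr_summ_coef (γ : ℝ) (hγ : 1 / 2 < γ) (c : ℕ → ℝ)
    (hc : Summable fun i => c i ^ 2 / krrMu γ i) (k : ℕ) :
    Summable fun i => |c i| * krrFr i ^ k := by
  have := (krr_cs (krrMu γ) c (fun i => krrFr i ^ k) (krrMu_pos γ) hc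
    ((krr_summ_mu γ hγ (k * 2)).congr fun i => by rw [pow_mul])).1
  refine this.congr fun i => ?_
  rw [abs_mul, abs_of_nonneg (pow_nonneg (krrFr_nonneg i) k)]

lemma krr_summ_D (γ : ℝ) (hγ : 1 / 2 < γ) (c : ℕ → ℝ)
    (hc : Summable fun i => c i ^ 2 / krrMu γ i) (k : ℕ) (x : ℝ) :
    Summable fun i => c i * krrD k i x := by
  refine Summable.of_norm_bounded ((krr_summ_coef γ hγ c hc k).mul_left 2) fun i => ?_
  rw [Real.norm_eq_abs, abs_mul]
  calc |c i| * |krrD k i x| ≤ |c i| * (2 * krrFr i ^ k) := by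
        gcongr; exact krrD_abs_le' k i x
    _ = _ := by ring

lemma fourierFun_eq (c : ℕ → ℝ) : fourierFun c = fun x => ∑' i, c i * krrD 0 i x := by
  funext x
  unfold fourierFun
  simp_rw [fourierPsi_eq]

lemma krr_iteratedDeriv (γ : ℝ) (hγ : 1 / 2 < γ) (c : ℕ → ℝ)
    (hc : Summable fun i => c i ^ 2 / krrMu γ i) (k : ℕ) (x : ℝ) :
    iteratedDeriv k (fourierFun c) x = ∑' i, c i * krrD k i x := by
  rw [fourierFun_eq]
  have hderiv : ∀ k i x, iteratedDeriv k (fun y => c i * krrD 0 i y) x = c i * krrD k i x := by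
    intro k i x
    rw [iteratedDeriv_const_mul_field, krrD_iteratedDeriv]
  have h := iteratedFDeriv_tsum_apply (𝕜 := ℝ) (N := ⊤) (f := fun i y => c i * krrD 0 i y)
    (v := fun k i => 2 * (|c i| * krrFr i ^ k))
    (fun i => contDiff_const.mul (krrD_contDiff 0 i))
    (fun k _ => (krr_summ_coef γ hγ c hc k).mul_left 2)
    (by
      intro k i x _
      rw [norm_iteratedFDeriv_eq_norm_iteratedDeriv, hderiv, Real.norm_eq_abs, abs_mul]
      calc |c i| * |krrD k i x| ≤ |c i| * (2 * krrFr i ^ k) := by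
            gcongr; exact krrD_abs_le' k i x
        _ = _ := by ring) (k := k) le_top x
  rw [iteratedDeriv_eq_iteratedFDeriv, h]
  have hs : Summable fun i => iteratedFDeriv ℝ k (fun y => c i * krrD 0 i y) x := by
    refine Summable.of_norm_bounded ((krr_summ_coef γ hγ c hc k).mul_left 2) fun i => ?_
    rw [norm_iteratedFDeriv_eq_norm_iteratedDeriv, hderiv, Real.norm_eq_abs, abs_mul]
    calc |c i| * |krrD k i x| ≤ |c i| * (2 * krrFr i ^ k) := by
            gcongr; exact krrD_abs_le' k i x
        _ = _ := by ring
  have h2 := ((ContinuousMultilinearMap.apply ℝ (fun _ : Fin k => ℝ) ℝ (fun _ => (1:ℝ))).map_tsum hs)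
  simp only [ContinuousMultilinearMap.apply_apply] at h2
  rw [h2]
  congr 1
  funext i
  rw [← hderiv, iteratedDeriv_eq_iteratedFDeriv]

lemma krr_L2 (k D : ℕ) (c : ℕ → ℝ) (R : ℝ → ℝ) (B : ℝ) (hR : ∀ x, R x ^ 2 ≤ B) :
    ∫ x in (0:ℝ)..1, (∑ i ∈ Finset.range D, c i * krrD k i x + R x) ^ 2 ≤
      2 * ∑ i ∈ Finset.range D, c i ^ 2 * krrFr i ^ (2 * k) + 2 * B := by
  have hcont : Continuous fun x => (∑ i ∈ Finset.range D, c i * krrD k i x) ^ 2 := by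
    have := krrD_continuous k
    fun_prop
  have h1 : ∫ x in (0:ℝ)..1, (∑ i ∈ Finset.range D, c i * krrD k i x + R x) ^ 2 ≤
      ∫ x in (0:ℝ)..1, (2 * (∑ i ∈ Finset.range D, c i * krrD k i x) ^ 2 + 2 * B) := by
    rw [intervalIntegral.integral_of_le zero_le_one, intervalIntegral.integral_of_le zero_le_one]
    apply integral_mono_of_nonneg
    · exact Filter.Eventually.of_forall fun x => sq_nonneg _
    · have : Continuous fun x => 2 * (∑ i ∈ Finset.range D, c i * krrD k i x) ^ 2 + 2 * B := by fun_prop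
      exact (this.intervalIntegrable 0 1).1
    · refine Filter.Eventually.of_forall fun x => ?_
      have := hR x
      simp only
      nlinarith [sq_nonneg (∑ i ∈ Finset.range D, c i * krrD k i x - R x)]
  refine h1.trans (le_of_eq ?_)
  rw [intervalIntegral.integral_add ((hcont.const_mul 2).intervalIntegrable _ _)
    (intervalIntegrable_const), intervalIntegral.integral_const_mul]
  have h2 : ∀ x, (∑ i ∈ Finset.range D, c i * krrD k i x) ^ 2 =
      ∑ i ∈ Finset.range D, ∑ l ∈ Finset.range D, c i * c l * (krrD k i x * krrD k l x) := by
    intro x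
    rw [sq, Finset.sum_mul_sum]
    refine Finset.sum_congr rfl fun i _ => Finset.sum_congr rfl fun l _ => by ring
  simp_rw [h2]
  have hii : ∀ i l, IntervalIntegrable (fun x => c i * c l * (krrD k i x * krrD k l x)) volume 0 1 := by
    intro i l
    have := krrD_continuous k
    apply Continuous.intervalIntegrable
    fun_prop
  have hout : ∀ i ∈ Finset.range D, IntervalIntegrable
      (fun x => ∑ l ∈ Finset.range D, c i * c l * (krrD k i x * krrD k l x)) volume 0 1 := by
    intro i _
    have := krrD_continuous k
    apply Continuous.intervalIntegrable
    fun_prop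
  rw [intervalIntegral.integral_finsetSum hout]
  have hin : ∀ i ∈ Finset.range D, ∫ x in (0:ℝ)..1, ∑ l ∈ Finset.range D,
      c i * c l * (krrD k i x * krrD k l x) = c i ^ 2 * krrFr i ^ (2 * k) := by
    intro i hi
    rw [intervalIntegral.integral_finsetSum (fun l _ => hii i l)]
    simp_rw [intervalIntegral.integral_const_mul, krrD_orth]
    simp only [mul_ite, mul_zero, Finset.sum_ite_eq, hi, if_true]
    ring
  rw [Finset.sum_congr rfl hin]
  simp


lemma expKernel_eq (γ x y : ℝ) :
    expKernel γ x y = ∑' i, krrMu γ i * (krrD 0 i x * krrD 0 i y) := by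
  unfold expKernel krrMu
  simp_rw [fourierPsi_eq, mul_assoc]

lemma krr_psi_abs_le (i : ℕ) (x : ℝ) : |krrD 0 i x| ≤ 2 := by
  simpa using krrD_abs_le' 0 i x

lemma expKernel_summable (γ : ℝ) (hγ : 1 / 2 < γ) (x y : ℝ) :
    Summable fun i => krrMu γ i * (krrD 0 i x * krrD 0 i y) := by
  have h := (krr_summ_mu γ hγ 0).mul_right 4
  refine Summable.of_norm_bounded h fun i => ?_
  rw [Real.norm_eq_abs, abs_mul, abs_mul, abs_of_pos (krrMu_pos γ i)]
  have h1 := krr_psi_abs_le i x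
  have h2 := krr_psi_abs_le i y
  have : |krrD 0 i x| * |krrD 0 i y| ≤ 2 * 2 := mul_le_mul h1 h2 (abs_nonneg _) (by norm_num)
  have h3 := krrMu_pos γ i
  simp only [pow_zero, mul_one]
  nlinarith

lemma krr_kernel_sum (γ : ℝ) (hγ : 1 / 2 < γ) (n : ℕ) (X w : Fin n → ℝ) (x : ℝ) :
    ∑ j, w j * expKernel γ x (X j) =
      fourierFun (fun i => krrMu γ i * ∑ j, w j * krrD 0 i (X j)) x := by
  rw [fourierFun_eq]
  simp_rw [expKernel_eq, ← tsum_mul_left]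
  rw [← Summable.tsum_finsetSum fun j _ => (expKernel_summable γ hγ x (X j)).mul_left (w j)]
  congr 1
  funext i
  rw [mul_assoc, Finset.sum_mul, Finset.mul_sum]
  refine Finset.sum_congr rfl fun j _ => by ring

lemma krr_coef_summable (γ : ℝ) (hγ : 1 / 2 < γ) (n : ℕ) (X w : Fin n → ℝ) :
    Summable fun i => (krrMu γ i * ∑ j, w j * krrD 0 i (X j)) ^ 2 / krrMu γ i := by
  have h := (krr_summ_mu γ hγ 0).mul_right ((∑ j, |w j| * 2) ^ 2)
  refine Summable.of_nonneg_of_le (fun i => div_nonneg (sq_nonneg _) (krrMu_pos γ i).le)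
    (fun i => ?_) h
  have h3 := krrMu_pos γ i
  have e : (krrMu γ i * ∑ j, w j * krrD 0 i (X j)) ^ 2 / krrMu γ i =
      krrMu γ i * |∑ j, w j * krrD 0 i (X j)| ^ 2 := by
    rw [sq_abs]; field_simp
  rw [e, pow_zero, mul_one]
  have h4 : |∑ j, w j * krrD 0 i (X j)| ≤ ∑ j, |w j| * 2 := by
    refine (Finset.abs_sum_le_sum_abs _ _).trans (Finset.sum_le_sum fun j _ => ?_)
    rw [abs_mul]
    exact mul_le_mul_of_nonneg_left (krr_psi_abs_le i _) (abs_nonneg _)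
  gcongr

lemma krr_kernel_psd (γ : ℝ) (hγ : 1 / 2 < γ) (n : ℕ) (X w : Fin n → ℝ) :
    0 ≤ ∑ i, w i * ∑ j, w j * expKernel γ (X i) (X j) := by
  simp_rw [expKernel_eq, ← tsum_mul_left]
  have hs : ∀ i j : Fin n, Summable fun m => w j * (krrMu γ m * (krrD 0 m (X i) * krrD 0 m (X j))) :=
    fun i j => (expKernel_summable γ hγ (X i) (X j)).mul_left (w j)
  have h1 : ∀ i, w i * ∑ j, ∑' m, w j * (krrMu γ m * (krrD 0 m (X i) * krrD 0 m (X j))) =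
     ∑' m, w i * ∑ j, w j * (krrMu γ m * (krrD 0 m (X i) * krrD 0 m (X j))) := by
    intro i
    rw [← Summable.tsum_finsetSum fun j _ => hs i j, tsum_mul_left]
  simp_rw [h1]
  rw [← Summable.tsum_finsetSum fun i _ => (summable_sum fun j _ => hs i j).mul_left (w i)]
  apply tsum_nonneg
  intro m
  have : ∑ i, w i * ∑ j, w j * (krrMu γ m * (krrD 0 m (X i) * krrD 0 m (X j))) =
      krrMu γ m * (∑ i, w i * krrD 0 m (X i)) ^ 2 := by
    rw [sq, Finset.sum_mul_sum, Finset.mul_sum]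
    refine Finset.sum_congr rfl fun i _ => ?_
    rw [Finset.mul_sum, Finset.mul_sum]
    refine Finset.sum_congr rfl fun j _ => by ring
  rw [this]
  exact mul_nonneg (krrMu_pos γ m).le (sq_nonneg _)

lemma krr_repr (γ : ℝ) (hγ : 1 / 2 < γ) (n : ℕ) (hn : 1 ≤ n) (f₀ : ℝ → ℝ) (ω : Fin n → ℝ × ℝ) :
    ∃ w : Fin n → ℝ,
      krrEstimator (expKernel γ) f₀ n (1 / n) ω =
        fourierFun (fun i => krrMu γ i * ∑ j, w j * krrD 0 i (ω j).1) ∧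
      ∀ j, w j = f₀ (ω j).1 + (ω j).2 -
        fourierFun (fun i => krrMu γ i * ∑ j, w j * krrD 0 i (ω j).1) (ω j).1 := by
  set M : Matrix (Fin n) (Fin n) ℝ := (Matrix.of fun (i j : Fin n) => expKernel γ (ω i).1 (ω j).1) +
        ((n : ℝ) * (1 / n)) • (1 : Matrix (Fin n) (Fin n) ℝ) with hM
  set Y : Fin n → ℝ := fun j : Fin n => f₀ (ω j).1 + (ω j).2 with hY
  have hn0 : (n:ℝ) ≠ 0 := by positivity
  have hMv : ∀ (v : Fin n → ℝ) i, (M *ᵥ v) i = ∑ j, v j * expKernel γ (ω i).1 (ω j).1 + v i := by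
    intro v i
    rw [hM, Matrix.add_mulVec, Pi.add_apply, mul_one_div_cancel hn0, one_smul, Matrix.one_mulVec]
    simp only [Matrix.mulVec, dotProduct, Matrix.of_apply]
    congr 1
    exact Finset.sum_congr rfl fun j _ => mul_comm _ _
  have hdet : IsUnit M := by
    rw [← Matrix.mulVec_injective_iff_isUnit]
    intro u v huv
    have h0 : M *ᵥ (u - v) = 0 := by rw [Matrix.mulVec_sub]; exact sub_eq_zero.2 huv
    set d := u - v with hd
    have h1 : ∑ i, d i * (M *ᵥ d) i = 0 := by rw [h0]; simp
    simp_rw [hMv, mul_add, Finset.sum_add_distrib] at h1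
    have h2 := krr_kernel_psd γ hγ n (fun j => (ω j).1) d
    have h3 : ∑ i, d i * d i = 0 :=
      le_antisymm (by linarith) (Finset.sum_nonneg fun i _ => mul_self_nonneg _)
    rw [Finset.sum_eq_zero_iff_of_nonneg fun i _ => mul_self_nonneg _] at h3
    have : d = 0 := by
      funext i
      simpa using h3 i (Finset.mem_univ i)
    exact sub_eq_zero.1 this
  have hw : M *ᵥ (M⁻¹ *ᵥ Y) = Y := by
    rw [Matrix.mulVec_mulVec, Matrix.mul_nonsing_inv _ ((Matrix.isUnit_iff_isUnit_det _).1 hdet),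
      Matrix.one_mulVec]
  refine ⟨M⁻¹ *ᵥ Y, ?_, ?_⟩
  · funext x
    rw [← krr_kernel_sum γ hγ n (fun j => (ω j).1) (M⁻¹ *ᵥ Y) x]
    rfl
  · intro j
    have := congrFun hw j
    rw [hMv, krr_kernel_sum γ hγ n (fun j => (ω j).1) (M⁻¹ *ᵥ Y)] at this
    have hYj : Y j = f₀ (ω j).1 + (ω j).2 := rfl
    rw [← hYj]
    linarith

lemma krr_core (γ : ℝ) (hγ : 1 / 2 < γ) (f h : ℕ → ℝ)
    (hf : Summable fun i => f i ^ 2 / krrMu γ i) (hh : Summable fun i => h i ^ 2 / krrMu γ i)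
    (n D : ℕ) (hn : 1 ≤ n) (hD1 : 1 ≤ D) (X ε w : Fin n → ℝ)
    (ha : ∀ i, h i + f i = krrMu γ i * ∑ j, w j * krrD 0 i (X j))
    (hw : ∀ j, w j = ε j - fourierFun h (X j))
    (hG : ∀ i < D, ∀ l < D, |∑ j, krrD 0 i (X j) * krrD 0 l (X j) - (if i = l then (n:ℝ) else 0)|
      ≤ n / (2 * D))
    (V U : ℝ) (hV : ∑ i ∈ Finset.range D, (∑ j, ε j * krrD 0 i (X j)) ^ 2 ≤ V)
    (hUs : Summable fun i => krrMu γ (i + D) * (∑ j, ε j * krrD 0 (i + D) (X j)) ^ 2)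
    (hU : ∑' i, krrMu γ (i + D) * (∑ j, ε j * krrD 0 (i + D) (X j)) ^ 2 ≤ U)
    (hTs : Summable fun i => krrMu γ (i + D) * (2:ℝ) ^ 2)
    (hT : n * ∑' i, krrMu γ (i + D) * (2:ℝ) ^ 2 ≤ 1 / 2) :
    (∑' i, h i ^ 2 / krrMu γ i) / 4 + n * (∑ i ∈ Finset.range D, h i ^ 2) / 8 ≤
      2 * V / n + 2 * U + 2 * ∑' i, f i ^ 2 / krrMu γ i := by
  set S := ∑' i, h i ^ 2 / krrMu γ i with hS
  set A := ∑ i ∈ Finset.range D, h i ^ 2 with hA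
  set F := ∑' i, f i ^ 2 / krrMu γ i with hF
  set Z : ℕ → ℝ := fun i => ∑ j, ε j * krrD 0 i (X j) with hZ
  have hn' : (0:ℝ) < n := by exact_mod_cast hn
  have hμ := krrMu_pos γ
  have hS0 : 0 ≤ S := tsum_nonneg fun i => div_nonneg (sq_nonneg _) (hμ i).le
  have hsum : ∀ x, Summable fun i => h i * krrD 0 i x := krr_summ_D γ hγ h hh 0
  have hfun : ∀ x, fourierFun h x = ∑' i, h i * krrD 0 i x := fun x => by rw [fourierFun_eq]
  -- swap for weighted sums
  have swap : ∀ v : Fin n → ℝ, HasSum (fun i => h i * ∑ j, v j * krrD 0 i (X j))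
      (∑ j, v j * fourierFun h (X j)) := by
    intro v
    have h1 : HasSum (fun i => ∑ j, v j * (h i * krrD 0 i (X j))) (∑ j, v j * fourierFun h (X j)) := by
      apply hasSum_sum
      intro j _
      rw [hfun]
      exact (hsum (X j)).hasSum.mul_left (v j)
    refine h1.congr_fun ?_ |> fun h => h
    intro i
    rw [Finset.mul_sum]
    exact Finset.sum_congr rfl fun j _ => by ring
  set Q := ∑ j, fourierFun h (X j) ^ 2 with hQ
  -- cross sum with f
  have hcross : HasSum (fun i => f i * h i / krrMu γ i) (∑ j, w j * fourierFun h (X j) - S) := by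
    refine ((swap w).sub hh.hasSum).congr_fun ?_
    intro i
    have := (hμ i).ne'
    have h1 : ∑ j, w j * krrD 0 i (X j) = (h i + f i) / krrMu γ i := by
      rw [ha]; field_simp
    rw [h1]; field_simp; ring
  have hnoise := swap ε
  have hwsum : ∑ j, w j * fourierFun h (X j) = ∑ j, ε j * fourierFun h (X j) - Q := by
    rw [hQ, ← Finset.sum_sub_distrib]
    refine Finset.sum_congr rfl fun j _ => ?_
    rw [hw j]; ring
  -- bound cross sum
  have hc : -(∑ j, w j * fourierFun h (X j) - S) ≤ S / 8 + 2 * F := by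
    have h1 : HasSum (fun i => h i ^ 2 / krrMu γ i / 8 + 2 * (f i ^ 2 / krrMu γ i)) (S / 8 + 2 * F) :=
      (hh.hasSum.div_const 8).add (hf.hasSum.mul_left 2)
    refine hasSum_le ?_ hcross.neg h1
    intro i
    have := hμ i
    have e : h i ^ 2 / krrMu γ i / 8 + 2 * (f i ^ 2 / krrMu γ i) - -(f i * h i / krrMu γ i)
      = (h i + 4 * f i) ^ 2 / 8 / krrMu γ i := by field_simp; ring
    have : 0 ≤ (h i + 4 * f i) ^ 2 / 8 / krrMu γ i := by positivity
    linarith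
  -- bound noise
  have hN : ∑ j, ε j * fourierFun h (X j) ≤ n * A / 8 + 2 * V / n + S / 8 + 2 * U := by
    rw [← hnoise.tsum_eq, ← hnoise.summable.sum_add_tsum_nat_add D]
    have h1 : ∑ i ∈ Finset.range D, h i * Z i ≤ n * A / 8 + 2 * V / n := by
      have h2 : ∑ i ∈ Finset.range D, h i * Z i ≤
          ∑ i ∈ Finset.range D, (n / 8 * h i ^ 2 + 2 / n * Z i ^ 2) := by
        refine Finset.sum_le_sum fun i _ => ?_
        have e : n / 8 * h i ^ 2 + 2 / n * Z i ^ 2 - h i * Z i = (n * h i - 4 * Z i) ^ 2 / (8 * n) := by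
          field_simp; ring
        have : 0 ≤ (n * h i - 4 * Z i) ^ 2 / (8 * n) := by positivity
        linarith
      rw [Finset.sum_add_distrib, ← Finset.mul_sum, ← Finset.mul_sum] at h2
      have h3 : 2 / (n:ℝ) * ∑ i ∈ Finset.range D, Z i ^ 2 ≤ 2 / n * V :=
        mul_le_mul_of_nonneg_left hV (by positivity)
      calc _ ≤ _ := h2
        _ ≤ n / 8 * A + 2 / n * V := by linarith
        _ = _ := by ring
    have h4 : ∑' i, h (i + D) * Z (i + D) ≤ S / 8 + 2 * U := by
      have hh' : Summable fun i => h (i + D) ^ 2 / krrMu γ (i + D) :=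
        (summable_nat_add_iff (f := fun i => h i ^ 2 / krrMu γ i) D).2 hh
      have hs1 : Summable fun i => h (i + D) * Z (i + D) :=
        (summable_nat_add_iff (f := fun i => h i * Z i) D).2 hnoise.summable
      have h5 : ∑' i, h (i + D) * Z (i + D) ≤
          ∑' i, (h (i + D) ^ 2 / krrMu γ (i + D) / 8 + 2 * (krrMu γ (i + D) * Z (i + D) ^ 2)) := by
        refine hs1.tsum_le_tsum ?_ ((hh'.div_const 8).add (hUs.mul_left 2))
        intro i
        have := hμ (i + D)
        have e : h (i + D) ^ 2 / krrMu γ (i + D) / 8 + 2 * (krrMu γ (i + D) * Z (i + D) ^ 2)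
          - h (i + D) * Z (i + D) = (h (i + D) - 4 * krrMu γ (i + D) * Z (i + D)) ^ 2 /
            (8 * krrMu γ (i + D)) := by
          field_simp; ring
        have : 0 ≤ (h (i + D) - 4 * krrMu γ (i + D) * Z (i + D)) ^ 2 /
            (8 * krrMu γ (i + D)) := by positivity
        linarith
      rw [(hh'.div_const 8).tsum_add (hUs.mul_left 2), tsum_div_const, tsum_mul_left] at h5
      have h6 : ∑' i, h (i + D) ^ 2 / krrMu γ (i + D) ≤ S := by
        rw [hS, ← hh.sum_add_tsum_nat_add D]
        have : 0 ≤ ∑ i ∈ Finset.range D, h i ^ 2 / krrMu γ i :=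
          Finset.sum_nonneg fun i _ => div_nonneg (sq_nonneg _) (hμ i).le
        linarith
      have hU' : ∑' i, krrMu γ (i + D) * Z (i + D) ^ 2 ≤ U := hU
      linarith
    have h7 : ∑' i, h (i + D) * ∑ j, ε j * krrD 0 (i + D) (X j) = ∑' i, h (i + D) * Z (i + D) := rfl
    have h8 : ∑ i ∈ Finset.range D, h i * ∑ j, ε j * krrD 0 i (X j) =
      ∑ i ∈ Finset.range D, h i * Z i := rfl
    rw [h7, h8]
    linarith
  -- lower bound on Q
  have hQl : n * A / 4 - S / 2 ≤ Q := by
    set P : ℝ → ℝ := fun x => ∑ i ∈ Finset.range D, h i * krrD 0 i x with hP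
    set R : ℝ → ℝ := fun x => ∑' i, h (i + D) * krrD 0 (i + D) x with hR
    have hsplit : ∀ x, fourierFun h x = P x + R x := fun x => by
      rw [hfun, ← (hsum x).sum_add_tsum_nat_add D]
    have hcs := krr_cs_tail (krrMu γ) h (fun _ => 2) D hμ hh hTs
    have hRb : ∀ x, R x ^ 2 ≤ S * ∑' i, krrMu γ (i + D) * (2:ℝ) ^ 2 := by
      intro x
      refine le_trans ?_ hcs.2
      rw [← sq_abs]
      refine pow_le_pow_left₀ (abs_nonneg _) ?_ 2
      have := tsum_of_norm_bounded (f := fun i => h (i + D) * krrD 0 (i + D) x) hcs.1.hasSum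
        (fun i => by
          rw [Real.norm_eq_abs, abs_mul, abs_mul]
          refine mul_le_mul_of_nonneg_left ?_ (abs_nonneg _)
          simpa using krr_psi_abs_le (i + D) x)
      simpa [hR] using this
    have hRsum : ∑ j, R (X j) ^ 2 ≤ S / 2 := by
      calc ∑ j, R (X j) ^ 2 ≤ ∑ j : Fin n, S * ∑' i, krrMu γ (i + D) * (2:ℝ) ^ 2 :=
            Finset.sum_le_sum fun j _ => hRb _
        _ = S * (n * ∑' i, krrMu γ (i + D) * (2:ℝ) ^ 2) := by
            rw [Finset.sum_const, Finset.card_univ, Fintype.card_fin, nsmul_eq_mul]; ring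
        _ ≤ S * (1 / 2) := mul_le_mul_of_nonneg_left hT hS0
        _ = S / 2 := by ring
    have hPsum : n * A / 2 ≤ ∑ j, P (X j) ^ 2 := by
      have e1 : ∑ j, P (X j) ^ 2 = ∑ i ∈ Finset.range D, ∑ l ∈ Finset.range D,
          h i * h l * ∑ j, krrD 0 i (X j) * krrD 0 l (X j) := by
        simp_rw [hP, sq, Finset.sum_mul_sum]
        rw [Finset.sum_comm]
        refine Finset.sum_congr rfl fun i _ => ?_
        rw [Finset.sum_comm]
        refine Finset.sum_congr rfl fun l _ => ?_
        rw [Finset.mul_sum]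
        exact Finset.sum_congr rfl fun j _ => by ring
      have e2 : n * A = ∑ i ∈ Finset.range D, ∑ l ∈ Finset.range D,
          h i * h l * (if i = l then (n:ℝ) else 0) := by
        rw [hA, Finset.mul_sum]
        refine Finset.sum_congr rfl fun i hi => ?_
        simp only [mul_ite, mul_zero, Finset.sum_ite_eq, hi, if_true]
        ring
      have e3 : n * A - ∑ j, P (X j) ^ 2 ≤ ∑ i ∈ Finset.range D, ∑ l ∈ Finset.range D,
          |h i| * |h l| * (n / (2 * D)) := by
        rw [e1, e2, ← Finset.sum_sub_distrib]
        refine Finset.sum_le_sum fun i hi => ?_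
        rw [← Finset.sum_sub_distrib]
        refine Finset.sum_le_sum fun l hl => ?_
        rw [← mul_sub]
        refine (le_abs_self _).trans ?_
        rw [abs_mul, abs_mul, abs_sub_comm]
        exact mul_le_mul_of_nonneg_left (hG i (Finset.mem_range.1 hi) l (Finset.mem_range.1 hl))
          (mul_nonneg (abs_nonneg _) (abs_nonneg _))
      have e4 : ∑ i ∈ Finset.range D, ∑ l ∈ Finset.range D,
          |h i| * |h l| * (n / (2 * D)) = (∑ i ∈ Finset.range D, |h i|) ^ 2 * (n / (2 * D)) := by
        rw [sq, Finset.sum_mul_sum, Finset.sum_mul]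
        refine Finset.sum_congr rfl fun i _ => ?_
        rw [Finset.sum_mul]
      have e5 : (∑ i ∈ Finset.range D, |h i|) ^ 2 ≤ D * A := by
        have := sq_sum_le_card_mul_sum_sq (s := Finset.range D) (f := fun i => |h i|)
        simpa [sq_abs] using this
      have hD' : (0:ℝ) < D := by exact_mod_cast hD1
      have e6 : (∑ i ∈ Finset.range D, |h i|) ^ 2 * (n / (2 * D)) ≤ D * A * (n / (2 * D)) :=
        mul_le_mul_of_nonneg_right e5 (by positivity)
      have e7 : D * A * (n / (2 * D)) = n * A / 2 := by field_simp
      linarith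
    have hj : ∑ j, (P (X j) ^ 2 / 2 - R (X j) ^ 2) ≤ Q := by
      refine Finset.sum_le_sum fun j _ => ?_
      rw [hsplit]
      nlinarith [sq_nonneg (P (X j) + 2 * R (X j))]
    rw [Finset.sum_sub_distrib, ← Finset.sum_div] at hj
    linarith
  linarith


set_option maxHeartbeats 4000000 in
lemma krr_final (γ σ : ℝ) (hγ : 1 / 2 < γ) (k : ℕ) (f : ℕ → ℝ)
    (hf : Summable fun i => f i ^ 2 / krrMu γ i) :
    ∃ C : ℝ, 0 < C ∧ ∃ N : ℕ, ∀ n : ℕ, N ≤ n → ∀ ω : Fin n → ℝ × ℝ,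
      (∀ i < ⌈4 * Real.log n⌉₊, ∀ l < ⌈4 * Real.log n⌉₊,
        |∑ j, krrD 0 i (ω j).1 * krrD 0 l (ω j).1 - (if i = l then (n:ℝ) else 0)|
          ≤ n / (2 * ⌈4 * Real.log n⌉₊)) →
      (∀ i : ℕ, (∑ j, (ω j).2 * krrD 0 i (ω j).1) ^ 2 ≤ 4 * σ ^ 2 * n * (12 * Real.log n + i)) →
      Real.sqrt (∫ x in (0 : ℝ)..1,
              (iteratedDeriv k (krrEstimator (expKernel γ) (fourierFun f) n (1 / n) ω) x -
                iteratedDeriv k (fourierFun f) x) ^ 2) ≤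
            C * Real.log n ^ (k + 1) / Real.sqrt n := by
  have hμ := krrMu_pos γ
  have hq2 : Summable fun i : ℕ => Real.exp (-(i:ℝ) / 2) * (12 + (i:ℝ)) := by
    have := ((krr_summ_half_pow 0).mul_left 12).add (krr_summ_half_pow 1)
    refine this.congr fun i => by ring
  have hq3 : Summable fun i : ℕ => Real.exp (-(i:ℝ) / 2) * (2:ℝ) ^ 2 := by
    have := ((krr_summ_half_pow 0).mul_left (2 ^ 2))
    refine this.congr fun i => by ring
  have hqk : Summable fun i : ℕ => Real.exp (-(i:ℝ) / 2) * (2 * krrFr i ^ k) ^ 2 := by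
    have := ((krr_summ_half_fr (2 * k)).mul_left (2 ^ 2))
    refine this.congr fun i => by ring
  set c2 := ∑' i : ℕ, Real.exp (-(i:ℝ) / 2) * (12 + (i:ℝ)) with hc2
  set c3 := ∑' i : ℕ, Real.exp (-(i:ℝ) / 2) * (2:ℝ) ^ 2 with hc3
  set ck := ∑' i : ℕ, Real.exp (-(i:ℝ) / 2) * (2 * krrFr i ^ k) ^ 2 with hck
  set F := ∑' i, f i ^ 2 / krrMu γ i with hF
  have hc20 : 0 ≤ c2 := tsum_nonneg fun i => by positivity
  have hc30 : 0 ≤ c3 := tsum_nonneg fun i => by positivity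
  have hck0 : 0 ≤ ck := tsum_nonneg fun i => by positivity
  have hF0 : 0 ≤ F := tsum_nonneg fun i => div_nonneg (sq_nonneg _) (hμ i).le
  set B := 680 * σ ^ 2 + 8 * σ ^ 2 * c2 + 2 * F with hB
  have hB0 : 0 ≤ B := by positivity
  set G := 16 * 20 ^ (2 * k) * B + 8 * B * ck + 1 with hGdef
  have hG0 : 0 < G := by positivity
  refine ⟨Real.sqrt G, Real.sqrt_pos.2 hG0, max 3 ⌈2 * c3⌉₊, ?_⟩
  intro n hnN ω hG hZ
  have hn3 : 3 ≤ n := (le_max_left _ _).trans hnN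
  have hn1 : 1 ≤ n := by omega
  have hnc : 2 * c3 ≤ n := (Nat.le_ceil _).trans (by exact_mod_cast (le_max_right _ _).trans hnN)
  have hn' : (0:ℝ) < n := by exact_mod_cast hn1
  have hn1' : (1:ℝ) ≤ n := by exact_mod_cast hn1
  set L := Real.log n with hL
  have hL1 : 1 ≤ L := by
    rw [hL, Real.le_log_iff_exp_le hn']
    have : (3:ℝ) ≤ n := by exact_mod_cast hn3
    linarith [Real.exp_one_lt_d9]
  set D := ⌈4 * L⌉₊ with hD
  have hD4 : 4 * L ≤ D := Nat.le_ceil _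
  have hD5 : (D:ℝ) ≤ 5 * L := by
    have := (Nat.ceil_lt_add_one (show 0 ≤ 4 * L by linarith)).le
    linarith
  have hD1 : 1 ≤ D := by
    have : (1:ℝ) ≤ D := by linarith
    exact_mod_cast this
  obtain ⟨w, hw1, hw2⟩ := krr_repr γ hγ n hn1 (fourierFun f) ω
  set a : ℕ → ℝ := fun i => krrMu γ i * ∑ j, w j * krrD 0 i (ω j).1 with ha
  have has : Summable fun i => a i ^ 2 / krrMu γ i :=
    krr_coef_summable γ hγ n (fun j => (ω j).1) w
  set h : ℕ → ℝ := fun i => a i - f i with hh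
  have hhs : Summable fun i => h i ^ 2 / krrMu γ i := by
    refine Summable.of_nonneg_of_le (fun i => div_nonneg (sq_nonneg _) (hμ i).le) (fun i => ?_)
      ((has.mul_left 2).add (hf.mul_left 2))
    rw [← mul_div_assoc, ← mul_div_assoc, ← add_div]
    have := hμ i
    gcongr
    simp only [hh]
    nlinarith [sq_nonneg (a i + f i)]
  have hsub : ∀ (k : ℕ) x, ∑' i, a i * krrD k i x - ∑' i, f i * krrD k i x = ∑' i, h i * krrD k i x := by
    intro k x
    rw [← (krr_summ_D γ hγ a has k x).tsum_sub (krr_summ_D γ hγ f hf k x)]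
    congr 1; funext i; simp only [hh]; ring
  have hfs : ∀ x, fourierFun h x = fourierFun a x - fourierFun f x := by
    intro x
    rw [fourierFun_eq, fourierFun_eq, fourierFun_eq]
    exact (hsub 0 x).symm
  -- tail facts
  obtain ⟨hTs, hTb⟩ := krr_tail γ hγ n D hn1 hD4 (fun _ => (2:ℝ) ^ 2) (fun _ => by positivity) hq3
  obtain ⟨hks, hkb⟩ := krr_tail γ hγ n D hn1 hD4 (fun i => (2 * krrFr i ^ k) ^ 2)
    (fun _ => by positivity) hqk
  have hq2' : Summable fun i : ℕ => Real.exp (-(i:ℝ) / 2) * (4 * σ ^ 2 * n * L * (12 + (i:ℝ))) := by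
    refine (hq2.mul_left (4 * σ ^ 2 * n * L)).congr fun i => by ring
  have hq2e : ∑' i : ℕ, Real.exp (-(i:ℝ) / 2) * (4 * σ ^ 2 * n * L * (12 + (i:ℝ))) =
      4 * σ ^ 2 * n * L * c2 := by
    rw [hc2, ← tsum_mul_left]; congr 1; funext i; ring
  obtain ⟨hUs, hUb⟩ := krr_tail γ hγ n D hn1 hD4 (fun i => 4 * σ ^ 2 * n * L * (12 + (i:ℝ)))
    (fun _ => by positivity) hq2'
  rw [hq2e] at hUb
  have hZ' : ∀ i : ℕ, (∑ j, (ω j).2 * krrD 0 i (ω j).1) ^ 2 ≤ 4 * σ ^ 2 * n * L * (12 + (i:ℝ)) := by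
    intro i
    refine (hZ i).trans ?_
    have h0 : (0:ℝ) ≤ i := Nat.cast_nonneg i
    have h1 : 12 * L + i ≤ L * (12 + i) := by nlinarith
    calc 4 * σ ^ 2 * n * (12 * L + i) ≤ 4 * σ ^ 2 * n * (L * (12 + i)) := by gcongr
      _ = _ := by ring
  have hUs' : Summable fun i => krrMu γ (i + D) * (∑ j, (ω j).2 * krrD 0 (i + D) (ω j).1) ^ 2 := by
    refine Summable.of_nonneg_of_le (fun i => mul_nonneg (hμ _).le (sq_nonneg _)) (fun i => ?_) hUs
    exact mul_le_mul_of_nonneg_left (hZ' _) (hμ _).le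
  have hU' : ∑' i, krrMu γ (i + D) * (∑ j, (ω j).2 * krrD 0 (i + D) (ω j).1) ^ 2 ≤
      4 * σ ^ 2 * c2 * L ^ 2 := by
    refine (hUs'.tsum_le_tsum (fun i => mul_le_mul_of_nonneg_left (hZ' _) (hμ _).le) hUs).trans ?_
    refine hUb.trans ?_
    have e : ((n:ℝ) ^ 2)⁻¹ * (4 * σ ^ 2 * n * L * c2) = 4 * σ ^ 2 * c2 * (L / n) := by
      field_simp
    rw [e]
    have : L / n ≤ L ^ 2 := by
      rw [div_le_iff₀ hn']
      nlinarith
    gcongr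
  have hV : ∑ i ∈ Finset.range D, (∑ j, (ω j).2 * krrD 0 i (ω j).1) ^ 2 ≤ 340 * σ ^ 2 * n * L ^ 2 := by
    calc _ ≤ ∑ i ∈ Finset.range D, 4 * σ ^ 2 * n * (17 * L) := by
          refine Finset.sum_le_sum fun i hi => (hZ i).trans ?_
          have h1 : (i:ℝ) ≤ D := by exact_mod_cast (Finset.mem_range.1 hi).le
          have : 12 * L + i ≤ 17 * L := by linarith
          gcongr
      _ = D * (4 * σ ^ 2 * n * (17 * L)) := by simp
      _ ≤ (5 * L) * (4 * σ ^ 2 * n * (17 * L)) := by gcongr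
      _ = _ := by ring
  have hT' : n * ∑' i, krrMu γ (i + D) * (2:ℝ) ^ 2 ≤ 1 / 2 := by
    calc n * ∑' i, krrMu γ (i + D) * (2:ℝ) ^ 2 ≤ n * (((n:ℝ) ^ 2)⁻¹ * c3) := by gcongr
      _ = c3 / n := by field_simp
      _ ≤ 1 / 2 := by rw [div_le_div_iff₀ hn' (by norm_num)]; linarith
  have core := krr_core γ hγ f h hf hhs n D hn1 hD1 (fun j => (ω j).1) (fun j => (ω j).2) w
    (fun i => by simp only [hh, ha]; ring)
    (fun j => by rw [hfs]; linarith [hw2 j])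
    hG (340 * σ ^ 2 * n * L ^ 2) (4 * σ ^ 2 * c2 * L ^ 2) hV hUs' hU' hTs hT'
  set S := ∑' i, h i ^ 2 / krrMu γ i with hS
  set A := ∑ i ∈ Finset.range D, h i ^ 2 with hA
  have hS0 : 0 ≤ S := tsum_nonneg fun i => div_nonneg (sq_nonneg _) (hμ i).le
  have hA0 : 0 ≤ A := Finset.sum_nonneg fun i _ => sq_nonneg _
  have hL2 : 1 ≤ L ^ 2 := by nlinarith
  have core2 : S / 4 + n * A / 8 ≤ B * L ^ 2 := by
    refine core.trans ?_
    have e : 2 * (340 * σ ^ 2 * n * L ^ 2) / n = 680 * σ ^ 2 * L ^ 2 := by field_simp; ring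
    rw [e, hB]
    nlinarith
  have hSb : S ≤ 4 * B * L ^ 2 := by
    have : 0 ≤ n * A / 8 := by positivity
    linarith
  have hAb : A ≤ 8 * B * L ^ 2 / n := by
    rw [le_div_iff₀ hn']; linarith
  -- derivative
  have hInt0 : ∀ x, iteratedDeriv k (krrEstimator (expKernel γ) (fourierFun f) n (1 / n) ω) x -
                iteratedDeriv k (fourierFun f) x =
      ∑ i ∈ Finset.range D, h i * krrD k i x + ∑' i, h (i + D) * krrD k (i + D) x := by
    intro x
    rw [hw1, krr_iteratedDeriv γ hγ a has, krr_iteratedDeriv γ hγ f hf, hsub,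
      (krr_summ_D γ hγ h hhs k x).sum_add_tsum_nat_add D]
  simp_rw [hInt0]
  have hcs := krr_cs_tail (krrMu γ) h (fun i => 2 * krrFr i ^ k) D hμ hhs hks
  have hbound := krr_L2 k D h (fun x => ∑' i, h (i + D) * krrD k (i + D) x)
    (S * ∑' i, krrMu γ (i + D) * (2 * krrFr (i + D) ^ k) ^ 2) (by
      intro x
      refine le_trans ?_ hcs.2
      rw [← sq_abs]
      refine pow_le_pow_left₀ (abs_nonneg _) ?_ 2
      have := tsum_of_norm_bounded (f := fun i => h (i + D) * krrD k (i + D) x) hcs.1.hasSum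
        (fun i => by
          rw [Real.norm_eq_abs, abs_mul, abs_mul]
          refine mul_le_mul_of_nonneg_left ?_ (abs_nonneg _)
          exact (krrD_abs_le' k (i + D) x).trans (le_abs_self _))
      simpa using this)
  have hsum1 : ∑ i ∈ Finset.range D, h i ^ 2 * krrFr i ^ (2 * k) ≤ A * (20 * L) ^ (2 * k) := by
    rw [hA, Finset.sum_mul]
    refine Finset.sum_le_sum fun i hi => ?_
    refine mul_le_mul_of_nonneg_left (pow_le_pow_left₀ (krrFr_nonneg i) ?_ _) (sq_nonneg _)
    have h1 : ((i + 1 : ℕ):ℝ) ≤ D := by exact_mod_cast (Finset.mem_range.1 hi)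
    push_cast at h1
    linarith [krrFr_le i]
  have hpowL : 1 ≤ L ^ (2 * k) := one_le_pow₀ hL1
  have hfinal : 2 * ∑ i ∈ Finset.range D, h i ^ 2 * krrFr i ^ (2 * k) +
      2 * (S * ∑' i, krrMu γ (i + D) * (2 * krrFr (i + D) ^ k) ^ 2) ≤
      G * (L ^ (k + 1)) ^ 2 / n := by
    have t1 : 2 * ∑ i ∈ Finset.range D, h i ^ 2 * krrFr i ^ (2 * k) ≤
        16 * 20 ^ (2 * k) * B * (L ^ (k + 1)) ^ 2 / n := by
      calc _ ≤ 2 * (8 * B * L ^ 2 / n * (20 * L) ^ (2 * k)) := by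
            gcongr
            exact hsum1.trans (by gcongr)
        _ = _ := by rw [mul_pow]; ring
    have t2 : 2 * (S * ∑' i, krrMu γ (i + D) * (2 * krrFr (i + D) ^ k) ^ 2) ≤
        8 * B * ck * (L ^ (k + 1)) ^ 2 / n := by
      have hinv : ((n:ℝ) ^ 2)⁻¹ ≤ (n:ℝ)⁻¹ := by
        apply inv_anti₀ hn'
        nlinarith
      have hT0 : ∑' i, krrMu γ (i + D) * (2 * krrFr (i + D) ^ k) ^ 2 ≤ (n:ℝ)⁻¹ * ck :=
        hkb.trans (by gcongr)
      calc _ ≤ 2 * (4 * B * L ^ 2 * ((n:ℝ)⁻¹ * ck)) := by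
            have h0 : 0 ≤ ∑' i, krrMu γ (i + D) * (2 * krrFr (i + D) ^ k) ^ 2 :=
              tsum_nonneg fun i => mul_nonneg (hμ _).le (sq_nonneg _)
            gcongr
        _ = 8 * B * ck * (L ^ 2 * 1) / n := by ring
        _ ≤ 8 * B * ck * (L ^ 2 * L ^ (2 * k)) / n := by gcongr
        _ = _ := by ring
    have t3 : 0 ≤ 1 * (L ^ (k + 1)) ^ 2 / n := by positivity
    calc _ ≤ 16 * 20 ^ (2 * k) * B * (L ^ (k + 1)) ^ 2 / n + 8 * B * ck * (L ^ (k + 1)) ^ 2 / n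
          + 1 * (L ^ (k + 1)) ^ 2 / n := by linarith
      _ = _ := by rw [hGdef]; ring
  refine (Real.sqrt_le_sqrt (hbound.trans hfinal)).trans (le_of_eq ?_)
  rw [Real.sqrt_div (by positivity), Real.sqrt_mul hG0.le, Real.sqrt_sq (by positivity)]


/-- law of a single data point -/
noncomputable def krrNu (σ : ℝ) : Measure (ℝ × ℝ) :=
  (volume.restrict (Set.Icc (0 : ℝ) 1)).prod (gaussianReal 0 (Real.toNNReal (σ ^ 2)))

instance krrUnif_prob : IsProbabilityMeasure (volume.restrict (Set.Icc (0 : ℝ) 1)) :=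
  ⟨by simp⟩

instance krrNu_prob (σ : ℝ) : IsProbabilityMeasure (krrNu σ) := by
  unfold krrNu; infer_instance

lemma regressionData_eq (σ : ℝ) (n : ℕ) :
    regressionData σ n = Measure.pi fun _ : Fin n => krrNu σ := rfl

instance regressionData_prob (σ : ℝ) (n : ℕ) : IsProbabilityMeasure (regressionData σ n) := by
  rw [regressionData_eq]; infer_instance

lemma krr_conc (σ : ℝ) (n : ℕ) (g : ℝ × ℝ → ℝ) (hg : Measurable g) (c : NNReal)
    (hsub : HasSubgaussianMGF g c (krrNu σ)) (t : ℝ) (ht : 0 ≤ t) :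
    regressionData σ n {ω | t ≤ |∑ j, g (ω j)|} ≤
      ENNReal.ofReal (2 * Real.exp (-t ^ 2 / (2 * (n * c)))) := by
  have one : ∀ g : ℝ × ℝ → ℝ, Measurable g → HasSubgaussianMGF g c (krrNu σ) →
      regressionData σ n {ω | t ≤ ∑ j, g (ω j)} ≤
      ENNReal.ofReal (Real.exp (-t ^ 2 / (2 * (n * c)))) := by
    intro g hg hsub
    rw [regressionData_eq]
    have hind : iIndepFun (fun (j : Fin n) (ω : Fin n → ℝ × ℝ) => g (ω j))
        (Measure.pi fun _ : Fin n => krrNu σ) :=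
      iIndepFun_pi (X := fun _ : Fin n => g) (fun _ => hg.aemeasurable)
    have hs : ∀ j ∈ (Finset.univ : Finset (Fin n)),
        HasSubgaussianMGF (fun ω : Fin n → ℝ × ℝ => g (ω j)) c
        (Measure.pi fun _ : Fin n => krrNu σ) := by
      intro j _
      refine HasSubgaussianMGF.of_map (X := g) (Y := fun ω : Fin n → ℝ × ℝ => ω j)
        (measurable_pi_apply j).aemeasurable ?_
      rw [(measurePreserving_eval (fun _ : Fin n => krrNu σ) j).map_eq]
      exact hsub
    have := HasSubgaussianMGF.measure_sum_ge_le_of_iIndepFun hind hs ht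
    rw [← ofReal_measureReal]
    apply ENNReal.ofReal_le_ofReal
    simpa using this
  have h1 := one g hg hsub
  have h2 := one (-g) hg.neg hsub.neg
  have hsubset : {ω : Fin n → ℝ × ℝ | t ≤ |∑ j, g (ω j)|} ⊆
      {ω | t ≤ ∑ j, g (ω j)} ∪ {ω | t ≤ ∑ j, (-g) (ω j)} := by
    intro ω hω
    simp only [Set.mem_ofPred_eq, Set.mem_union, Pi.neg_apply, Finset.sum_neg_distrib] at *
    exact le_abs.1 hω
  refine (measure_mono hsubset).trans ((measure_union_le _ _).trans ((add_le_add h1 h2).trans ?_))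
  rw [← ENNReal.ofReal_add (Real.exp_pos _).le (Real.exp_pos _).le, ← two_mul]

lemma krr_sub_design (σ : ℝ) (i l : ℕ) :
    HasSubgaussianMGF (fun p : ℝ × ℝ => krrD 0 i p.1 * krrD 0 l p.1 - (if i = l then 1 else 0)) 4
      (krrNu σ) := by
  have hci := krrD_continuous 0 i
  have hcl := krrD_continuous 0 l
  have h := hasSubgaussianMGF_of_mem_Icc (μ := krrNu σ) (a := -2) (b := 2)
    (X := fun p : ℝ × ℝ => krrD 0 i p.1 * krrD 0 l p.1)
    (by fun_prop)
    (Filter.Eventually.of_forall fun p => by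
      have h1 := krrD_sq_le i p.1
      have h2 := krrD_sq_le l p.1
      constructor
      · nlinarith [sq_nonneg (krrD 0 i p.1 + krrD 0 l p.1)]
      · nlinarith [sq_nonneg (krrD 0 i p.1 - krrD 0 l p.1)])
  have hmean : ∫ p, krrD 0 i p.1 * krrD 0 l p.1 ∂(krrNu σ) = if i = l then 1 else 0 := by
    unfold krrNu
    rw [integral_fun_fst (f := fun x => krrD 0 i x * krrD 0 l x)]
    have := krrD_orth 0 i l
    rw [intervalIntegral.integral_of_le zero_le_one, ← integral_Icc_eq_integral_Ioc] at this
    rw [this]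
    simp
  rw [hmean] at h
  convert h using 1
  rw [← NNReal.coe_inj]
  push_cast
  norm_num

lemma krr_sub_noise (σ : ℝ) (i : ℕ) :
    HasSubgaussianMGF (fun p : ℝ × ℝ => p.2 * krrD 0 i p.1) (2 * Real.toNNReal (σ ^ 2))
      (krrNu σ) := by
  have hci := krrD_continuous 0 i
  have hInt0 : ∀ t : ℝ, Integrable (fun p : ℝ × ℝ => Real.exp (t * (p.2 * krrD 0 i p.1))) (krrNu σ) := by
    intro t
    have h1 : Integrable (fun p : ℝ × ℝ => Real.exp ((2 * t) * p.2) + Real.exp ((-(2 * t)) * p.2))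
        (krrNu σ) := by
      unfold krrNu
      exact ((integrable_exp_mul_gaussianReal (2 * t)).comp_snd _).add
        ((integrable_exp_mul_gaussianReal (-(2 * t))).comp_snd _)
    refine h1.mono' (by fun_prop) (Filter.Eventually.of_forall fun p => ?_)
    rw [Real.norm_eq_abs, Real.abs_exp]
    have hb : t * (p.2 * krrD 0 i p.1) ≤ |2 * t * p.2| := by
      refine (le_abs_self _).trans ?_
      have := krr_psi_abs_le i p.1
      rw [abs_mul, abs_mul, abs_mul, abs_mul]
      simp only [abs_two]
      have h0 : 0 ≤ |t| * |p.2| := by positivity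
      nlinarith
    refine (Real.exp_le_exp.2 hb).trans ?_
    rcases abs_cases (2 * t * p.2) with ⟨h, _⟩ | ⟨h, _⟩
    · rw [h]; linarith [Real.exp_pos (-(2 * t) * p.2)]
    · rw [h, ← neg_mul]; linarith [Real.exp_pos (2 * t * p.2)]
  refine ⟨hInt0, fun t => ?_⟩
  unfold mgf
  have hi := hInt0 t
  unfold krrNu at hi ⊢
  rw [integral_prod _ hi]
  have hin : ∀ x, ∫ y, Real.exp (t * (y * krrD 0 i x)) ∂(gaussianReal 0 (Real.toNNReal (σ ^ 2))) =
      Real.exp (σ ^ 2 * (t * krrD 0 i x) ^ 2 / 2) := by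
    intro x
    have := congrFun (mgf_fun_id_gaussianReal (μ := 0) (v := Real.toNNReal (σ ^ 2))) (t * krrD 0 i x)
    unfold mgf at this
    rw [Real.coe_toNNReal _ (sq_nonneg σ), zero_mul, zero_add] at this
    rw [← this]
    congr 1; funext y; congr 1; ring
  simp only [hin]
  have hb := norm_integral_le_of_norm_le_const (μ := volume.restrict (Set.Icc (0:ℝ) 1))
    (f := fun x => Real.exp (σ ^ 2 * (t * krrD 0 i x) ^ 2 / 2)) (C := Real.exp (σ ^ 2 * t ^ 2))
    (Filter.Eventually.of_forall fun x => by
      rw [Real.norm_eq_abs, Real.abs_exp]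
      apply Real.exp_le_exp.2
      have := krrD_sq_le i x
      have h0 : 0 ≤ σ ^ 2 * t ^ 2 := by positivity
      rw [mul_pow]
      nlinarith)
  refine (le_abs_self _).trans (hb.trans (le_of_eq ?_))
  rw [probReal_univ, mul_one]
  congr 1
  push_cast
  rw [Real.coe_toNNReal _ (sq_nonneg σ)]
  ring

lemma krr_event_design (σ : ℝ) (n D : ℕ) (hn : 1 ≤ n) (hD : 1 ≤ D) (i l : ℕ) :
    regressionData σ n {ω | ¬ |∑ j, krrD 0 i (ω j).1 * krrD 0 l (ω j).1 - (if i = l then (n:ℝ) else 0)|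
          ≤ n / (2 * D)} ≤ ENNReal.ofReal (2 * Real.exp (-(n / (32 * (D:ℝ) ^ 2)))) := by
  have hci := krrD_continuous 0 i
  have hcl := krrD_continuous 0 l
  have h := krr_conc σ n (fun p : ℝ × ℝ => krrD 0 i p.1 * krrD 0 l p.1 - (if i = l then 1 else 0))
    (by fun_prop) 4 (krr_sub_design σ i l) (n / (2 * D)) (by positivity)
  have hn' : (0:ℝ) < n := by exact_mod_cast hn
  have hD' : (0:ℝ) < D := by exact_mod_cast hD
  have e : -((n:ℝ) / (2 * D)) ^ 2 / (2 * (n * (4:NNReal))) = -(n / (32 * (D:ℝ) ^ 2)) := by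
    push_cast
    field_simp
    norm_num
  rw [e] at h
  refine le_trans (measure_mono ?_) h
  intro ω hω
  simp only [Set.mem_ofPred_eq, not_le] at hω ⊢
  rw [Finset.sum_sub_distrib]
  refine hω.le.trans (le_of_eq ?_)
  congr 2
  split_ifs <;> simp

lemma krr_event_noise (σ : ℝ) (hσ : 0 < σ) (n : ℕ) (hn : 1 ≤ n) (i : ℕ) :
    regressionData σ n {ω | ¬ (∑ j, (ω j).2 * krrD 0 i (ω j).1) ^ 2 ≤
        4 * σ ^ 2 * n * (12 * Real.log n + i)} ≤
      ENNReal.ofReal (2 * ((n:ℝ) ^ 12)⁻¹ * Real.exp (-(i:ℝ))) := by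
  have hci := krrD_continuous 0 i
  have hn' : (0:ℝ) < n := by exact_mod_cast hn
  have hL : 0 ≤ Real.log n := Real.log_nonneg (by exact_mod_cast hn)
  have hpos : 0 ≤ 4 * σ ^ 2 * n * (12 * Real.log n + i) := by positivity
  have h := krr_conc σ n (fun p : ℝ × ℝ => p.2 * krrD 0 i p.1)
    (by fun_prop) _ (krr_sub_noise σ i) (Real.sqrt (4 * σ ^ 2 * n * (12 * Real.log n + i)))
    (Real.sqrt_nonneg _)
  have e : 2 * Real.exp (-Real.sqrt (4 * σ ^ 2 * n * (12 * Real.log n + i)) ^ 2 /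
      (2 * (n * (2 * Real.toNNReal (σ ^ 2) : NNReal)))) = 2 * ((n:ℝ) ^ 12)⁻¹ * Real.exp (-(i:ℝ)) := by
    rw [Real.sq_sqrt hpos]
    push_cast
    rw [Real.coe_toNNReal _ (sq_nonneg σ)]
    have e1 : -(4 * σ ^ 2 * n * (12 * Real.log n + i)) / (2 * (n * (2 * σ ^ 2))) =
      -(12 * Real.log n) + -(i:ℝ) := by field_simp; ring
    rw [e1, Real.exp_add, Real.exp_neg (12 * Real.log n)]
    have e2 : Real.exp (12 * Real.log n) = (n:ℝ) ^ 12 := by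
      have := Real.exp_nat_mul (Real.log n) 12
      rw [Real.exp_log hn'] at this
      exact_mod_cast this
    rw [e2]; ring
  rw [e] at h
  refine le_trans (measure_mono ?_) h
  intro ω hω
  simp only [Set.mem_ofPred_eq, not_le] at hω ⊢
  rw [Real.sqrt_le_left (abs_nonneg _), sq_abs]
  exact hω.le


lemma krr_bad_bound (σ : ℝ) (hσ : 0 < σ) : ∃ N : ℕ, ∀ n : ℕ, N ≤ n →
    regressionData σ n {ω : Fin n → ℝ × ℝ | ¬ ((∀ i < ⌈4 * Real.log n⌉₊, ∀ l < ⌈4 * Real.log n⌉₊,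
        |∑ j, krrD 0 i (ω j).1 * krrD 0 l (ω j).1 - (if i = l then (n:ℝ) else 0)|
          ≤ n / (2 * ⌈4 * Real.log n⌉₊)) ∧
      (∀ i : ℕ, (∑ j, (ω j).2 * krrD 0 i (ω j).1) ^ 2 ≤ 4 * σ ^ 2 * n * (12 * Real.log n + i)))} ≤
    ((n : ENNReal) ^ 10)⁻¹ := by
  have hexp : Summable fun i : ℕ => Real.exp (-(i:ℝ)) := Real.summable_exp_neg_nat
  set c0 := ∑' i : ℕ, Real.exp (-(i:ℝ)) with hc0
  have hlog := ((isLittleO_pow_log_id_atTop (n := 3)).comp_tendsto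
    (tendsto_natCast_atTop_atTop (R := ℝ))).bound (show (0:ℝ) < 1 / 9600 by norm_num)
  obtain ⟨N1, hN1⟩ := Filter.eventually_atTop.1 hlog
  refine ⟨max N1 (max 3 ⌈4 * c0⌉₊), fun n hn => ?_⟩
  have hn3 : 3 ≤ n := ((le_max_left _ _).trans (le_max_right _ _)).trans hn
  have hn1 : 1 ≤ n := by omega
  have hn' : (0:ℝ) < n := by exact_mod_cast hn1
  have hn1' : (1:ℝ) ≤ n := by exact_mod_cast hn1
  have hnc : 4 * c0 ≤ n := (Nat.le_ceil _).trans
    (by exact_mod_cast ((le_max_right _ _).trans (le_max_right _ _)).trans hn)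
  have hL3 := hN1 n ((le_max_left _ _).trans hn)
  set L := Real.log n with hL
  have hL1 : 1 ≤ L := by
    rw [hL, Real.le_log_iff_exp_le hn']
    have : (3:ℝ) ≤ n := by exact_mod_cast hn3
    linarith [Real.exp_one_lt_d9]
  have hL3' : 9600 * L ^ 3 ≤ n := by
    simp only [Function.comp, id, Real.norm_eq_abs] at hL3
    rw [abs_of_nonneg (by positivity), abs_of_pos hn'] at hL3
    linarith
  set D := ⌈4 * L⌉₊ with hD
  have hD4 : 4 * L ≤ D := Nat.le_ceil _
  have hD5 : (D:ℝ) ≤ 5 * L := by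
    have := (Nat.ceil_lt_add_one (show 0 ≤ 4 * L by linarith)).le
    linarith
  have hD1 : 1 ≤ D := by
    have : (1:ℝ) ≤ D := by linarith
    exact_mod_cast this
  have hD' : (0:ℝ) < D := by exact_mod_cast hD1
  have hsubset : {ω : Fin n → ℝ × ℝ | ¬ ((∀ i < D, ∀ l < D,
        |∑ j, krrD 0 i (ω j).1 * krrD 0 l (ω j).1 - (if i = l then (n:ℝ) else 0)|
          ≤ n / (2 * D)) ∧
      (∀ i : ℕ, (∑ j, (ω j).2 * krrD 0 i (ω j).1) ^ 2 ≤ 4 * σ ^ 2 * n * (12 * L + i)))} ⊆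
      (⋃ i ∈ Finset.range D, ⋃ l ∈ Finset.range D, {ω : Fin n → ℝ × ℝ |
        ¬ |∑ j, krrD 0 i (ω j).1 * krrD 0 l (ω j).1 - (if i = l then (n:ℝ) else 0)|
          ≤ n / (2 * D)}) ∪
      ⋃ i : ℕ, {ω : Fin n → ℝ × ℝ |
        ¬ (∑ j, (ω j).2 * krrD 0 i (ω j).1) ^ 2 ≤ 4 * σ ^ 2 * n * (12 * L + i)} := by
    intro ω hω
    rw [Set.mem_ofPred_eq, not_and_or] at hω
    rcases hω with hω | hω
    · left
      push Not at hω
      obtain ⟨i, hi, l, hl, h⟩ := hω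
      simp only [Set.mem_iUnion, Finset.mem_range, Set.mem_ofPred_eq, not_le]
      exact ⟨i, hi, l, hl, h⟩
    · right
      push Not at hω
      obtain ⟨i, h⟩ := hω
      simp only [Set.mem_iUnion, Set.mem_ofPred_eq, not_le]
      exact ⟨i, h⟩
  refine (measure_mono hsubset).trans ((measure_union_le _ _).trans ?_)
  have h10 : ((n : ENNReal) ^ 10)⁻¹ = ENNReal.ofReal (((n:ℝ) ^ 10)⁻¹ / 2) +
      ENNReal.ofReal (((n:ℝ) ^ 10)⁻¹ / 2) := by
    rw [← ENNReal.ofReal_add (by positivity) (by positivity), add_halves,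
      ENNReal.ofReal_inv_of_pos (by positivity), ENNReal.ofReal_pow hn'.le, ENNReal.ofReal_natCast]
  rw [h10]
  have h12 : ((n:ℝ) ^ 12)⁻¹ = ((n:ℝ) ^ 10)⁻¹ * ((n:ℝ) ^ 2)⁻¹ := by
    rw [← mul_inv, ← pow_add]
  refine add_le_add ?_ ?_
  · calc _ ≤ ∑ i ∈ Finset.range D, ∑ l ∈ Finset.range D,
          ENNReal.ofReal (2 * Real.exp (-(n / (32 * (D:ℝ) ^ 2)))) := by
          refine (measure_biUnion_finset_le _ _).trans (Finset.sum_le_sum fun i _ => ?_)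
          refine (measure_biUnion_finset_le _ _).trans (Finset.sum_le_sum fun l _ => ?_)
          exact krr_event_design σ n D hn1 hD1 i l
      _ = ENNReal.ofReal (D * (D * (2 * Real.exp (-(n / (32 * (D:ℝ) ^ 2)))))) := by
          simp only [Finset.sum_const, Finset.card_range, nsmul_eq_mul]
          rw [ENNReal.ofReal_mul hD'.le, ENNReal.ofReal_mul hD'.le, ENNReal.ofReal_natCast]
      _ ≤ _ := by
          apply ENNReal.ofReal_le_ofReal
          have hexp1 : Real.exp (-(n / (32 * (D:ℝ) ^ 2))) ≤ ((n:ℝ) ^ 12)⁻¹ := by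
            have e2 : Real.exp (12 * L) = (n:ℝ) ^ 12 := by
              have := Real.exp_nat_mul L 12
              rw [hL, Real.exp_log hn'] at this
              exact_mod_cast this
            rw [← e2, ← Real.exp_neg]
            apply Real.exp_le_exp.2
            apply neg_le_neg
            rw [le_div_iff₀ (by positivity)]
            have hDs : (D:ℝ) ^ 2 ≤ (5 * L) ^ 2 := pow_le_pow_left₀ hD'.le hD5 2
            calc 12 * L * (32 * (D:ℝ) ^ 2) ≤ 12 * L * (32 * (5 * L) ^ 2) := by gcongr
              _ = 9600 * L ^ 3 := by ring
              _ ≤ n := hL3'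
          have hDs : (D:ℝ) * D ≤ (5 * L) * (5 * L) := by gcongr
          calc (D:ℝ) * (D * (2 * Real.exp (-(n / (32 * (D:ℝ) ^ 2))))) =
              D * D * 2 * Real.exp (-(n / (32 * (D:ℝ) ^ 2))) := by ring
            _ ≤ (5 * L) * (5 * L) * 2 * ((n:ℝ) ^ 12)⁻¹ := by gcongr
            _ = ((n:ℝ) ^ 10)⁻¹ * (50 * L ^ 2 * ((n:ℝ) ^ 2)⁻¹) := by rw [h12]; ring
            _ ≤ ((n:ℝ) ^ 10)⁻¹ * (1 / 2) := by
              refine mul_le_mul_of_nonneg_left ?_ (by positivity)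
              rw [← div_eq_mul_inv, div_le_div_iff₀ (by positivity) (by norm_num)]
              have h1 : L ^ 2 ≤ L ^ 3 := pow_le_pow_right₀ hL1 (by norm_num)
              have h2 : (n:ℝ) ≤ n ^ 2 := by nlinarith
              nlinarith
            _ = _ := by ring
  · calc _ ≤ ∑' i : ℕ, ENNReal.ofReal (2 * ((n:ℝ) ^ 12)⁻¹ * Real.exp (-(i:ℝ))) :=
          (measure_iUnion_le _).trans
            (ENNReal.tsum_le_tsum fun i => krr_event_noise σ hσ n hn1 i)
      _ = ENNReal.ofReal (2 * ((n:ℝ) ^ 12)⁻¹ * c0) := by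
          rw [hc0, ← tsum_mul_left, ENNReal.ofReal_tsum_of_nonneg (fun i => by positivity)
            (hexp.mul_left _)]
      _ ≤ _ := by
          apply ENNReal.ofReal_le_ofReal
          rw [h12]
          calc 2 * (((n:ℝ) ^ 10)⁻¹ * ((n:ℝ) ^ 2)⁻¹) * c0
              = ((n:ℝ) ^ 10)⁻¹ * (2 * c0 * ((n:ℝ) ^ 2)⁻¹) := by ring
            _ ≤ ((n:ℝ) ^ 10)⁻¹ * (1 / 2) := by
              refine mul_le_mul_of_nonneg_left ?_ (by positivity)
              rw [← div_eq_mul_inv, div_le_div_iff₀ (by positivity) (by norm_num)]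
              have h2 : (n:ℝ) ≤ n ^ 2 := by nlinarith
              linarith
            _ = _ := by ring

theorem krr_derivative_rate_analytic (γ γ₀ σ : ℝ) (hγ : 1 / 2 < γ) (hγ₀ : γ < γ₀)
    (hσ : 0 < σ) (k : ℕ) (f : ℕ → ℝ)
    (hf : Summable fun i : ℕ => Real.exp (γ₀ * ((i : ℝ) + 1)) * |f i|) :
    ∃ C : ℝ, 0 < C ∧ ∃ N : ℕ, ∀ n : ℕ, N ≤ n →
      1 - ((n : ENNReal) ^ 10)⁻¹ ≤
        regressionData σ n
          {ω : Fin n → ℝ × ℝ |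
            Real.sqrt (∫ x in (0 : ℝ)..1,
              (iteratedDeriv k (krrEstimator (expKernel γ) (fourierFun f) n (1 / n) ω) x -
                iteratedDeriv k (fourierFun f) x) ^ 2) ≤
            C * Real.log n ^ (k + 1) / Real.sqrt n} := by
  have hf1 : Summable fun i : ℕ => Real.exp (γ * ((i : ℝ) + 1)) * |f i| := by
    refine Summable.of_nonneg_of_le (fun i => by positivity) (fun i => ?_) hf
    gcongr
  have hf2 : Summable fun i => f i ^ 2 / krrMu γ i := by
    have h2 : Summable fun i : ℕ => (Real.exp (γ * ((i : ℝ) + 1)) * |f i|) ^ 2 := by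
      have hz := hf1.tendsto_atTop_zero.eventually (ge_mem_nhds (show (0:ℝ) < 1 by norm_num))
      refine Summable.of_norm_bounded_eventually_nat hf1 ?_
      filter_upwards [hz] with i hi
      have h0 : 0 ≤ Real.exp (γ * ((i : ℝ) + 1)) * |f i| := by positivity
      rw [Real.norm_eq_abs, abs_of_nonneg (sq_nonneg _)]
      nlinarith
    refine h2.congr fun i => ?_
    unfold krrMu
    rw [mul_pow, sq_abs, div_eq_mul_inv, ← Real.exp_neg, ← Real.exp_nat_mul, mul_comm]
    congr 2
    push_cast
    ring
  obtain ⟨C, hC, N0, h0⟩ := krr_final γ σ hγ k f hf2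
  obtain ⟨N1, h1⟩ := krr_bad_bound σ hσ
  refine ⟨C, hC, max N0 N1, fun n hn => ?_⟩
  have hb := h1 n ((le_max_right _ _).trans hn)
  have hg := h0 n ((le_max_left _ _).trans hn)
  rw [tsub_le_iff_right]
  refine le_trans ?_ (add_le_add_right hb _)
  rw [← measure_univ (μ := regressionData σ n)]
  refine le_trans (measure_mono ?_) (measure_union_le _ _)
  intro ω _
  by_cases hω : ((∀ i < ⌈4 * Real.log n⌉₊, ∀ l < ⌈4 * Real.log n⌉₊,
        |∑ j, krrD 0 i (ω j).1 * krrD 0 l (ω j).1 - (if i = l then (n:ℝ) else 0)|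
          ≤ n / (2 * ⌈4 * Real.log n⌉₊)) ∧
      (∀ i : ℕ, (∑ j, (ω j).2 * krrD 0 i (ω j).1) ^ 2 ≤ 4 * σ ^ 2 * n * (12 * Real.log n + i)))
  · exact Or.inl (hg ω hω.1 hω.2)
  · exact Or.inr hω
end

section
/- Let k ∈ ℕ₀, α > k + 1/2, and σ > 0. Let (ψ_j)_{j≥1} be the Fourier basis on [0,1] and define the kernel K_α(x,x') = ∑_{i=1}^∞ i^{-2α} ψ_i(x) ψ_i(x') (the series and its term-by-term partial derivatives up to order k in each variable converge uniformly, so K_α ∈ C^{2k}). Let f₀ = ∑_{i=1}^∞ f_i ψ_i with ∑_{i=1}^∞ i^α |f_i| < ∞. For each n ≥ 2, let X₁,…,Xₙ be i.i.d. Uniform[0,1], let ε₁,…,εₙ be i.i.d. N(0, σ²) independent of the X's, and set Y_i = f₀(X_i) + ε_i. With λ_n = (log n / n)^{2α/(2α+1)}, define the kernel ridge/posterior-mean estimator f̂_n(x) = ∑_{i=1}^n w_i K_α(x, X_i) where w = (K_α(X,X) + nλ_n I_n)^{-1} Y and K_α(X,X) = (K_α(X_i, X_j))_{i,j=1}^n.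 Then there exist a constant C > 0 and N ∈ ℕ such that for all n ≥ N, with probability at least 1 − n^{-10} over the data, (∫_0^1 (f̂_n^{(k)}(x) − f₀^{(k)}(x))² dx)^{1/2} ≤ C (log n / n)^{(α−k)/(2α+1)}. -/
open MeasureTheory ProbabilityTheory Real Matrix

/-- The kernel with polynomially decaying eigenvalues `μ_i = i^{-2α}` relative to the
Fourier basis: `K_α(x, x') = ∑ i^{-2α} ψ_i(x) ψ_i(x')`. -/
noncomputable def polyKernel (α : ℝ) (x y : ℝ) : ℝ :=
  ∑' i : ℕ, ((i : ℝ) + 1) ^ (-(2 * α)) * fourierPsi (i + 1) x * fourierPsi (i + 1) y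

noncomputable def ampl (j : ℕ) : ℝ := if j = 0 then 1 else Real.sqrt 2
noncomputable def frq (j : ℕ) : ℝ := 2 * Real.pi * (((j + 1) / 2 : ℕ) : ℝ)
noncomputable def phs (j : ℕ) : ℝ := if (j + 1) % 2 = 0 ∨ j = 0 then 0 else - (Real.pi / 2)

noncomputable def dpsi (k j : ℕ) (x : ℝ) : ℝ :=
  ampl j * frq j ^ k * Real.cos (frq j * x + phs j + k * (Real.pi / 2))

lemma psi_eq (j : ℕ) (x : ℝ) : fourierPsi (j + 1) x = dpsi 0 j x := by
  unfold fourierPsi dpsi ampl frq phs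
  rcases Nat.eq_zero_or_pos j with h | h
  · subst h; simp
  · have h1 : j ≠ 0 := by omega
    by_cases h2 : (j + 1) % 2 = 0
    · simp [h1, h2]
    · simp only [h1, h2, Nat.add_eq_right, if_false, or_false, pow_zero, mul_one,
        Nat.cast_zero, zero_mul, add_zero]
      rw [← sub_eq_add_neg, Real.cos_sub_pi_div_two]

lemma frq_nonneg (j : ℕ) : 0 ≤ frq j := by unfold frq; positivity

lemma frq_le (j : ℕ) : frq j ≤ Real.pi * (j + 1) := by
  unfold frq
  have : (((j + 1) / 2 : ℕ) : ℝ) ≤ ((j : ℝ) + 1) / 2 := by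
    have := @Nat.cast_div_le ℝ _ _ _ (j + 1) 2
    push_cast at this ⊢
    exact this
  nlinarith [Real.pi_pos]

lemma ampl_nonneg (j : ℕ) : 0 ≤ ampl j := by unfold ampl; split_ifs <;> positivity
lemma ampl_le (j : ℕ) : ampl j ≤ Real.sqrt 2 := by
  unfold ampl; split_ifs
  · rw [Real.one_le_sqrt]; norm_num
  · exact le_rfl

lemma dpsi_hasDerivAt (k j : ℕ) (x : ℝ) : HasDerivAt (dpsi k j) (dpsi (k + 1) j x) x := by
  have h1 : HasDerivAt (fun x : ℝ => frq j * x + phs j + k * (Real.pi / 2)) (frq j) x := by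
    simpa using (((hasDerivAt_id x).const_mul (frq j)).add_const (phs j)).add_const
      (k * (Real.pi / 2))
  have h2 := (h1.cos).const_mul (ampl j * frq j ^ k)
  have h3 : dpsi (k + 1) j x = ampl j * frq j ^ k *
      (-Real.sin (frq j * x + phs j + k * (Real.pi / 2)) * frq j) := by
    unfold dpsi
    have : frq j * x + phs j + ((k + 1 : ℕ) : ℝ) * (Real.pi / 2)
      = (frq j * x + phs j + k * (Real.pi / 2)) + Real.pi / 2 := by push_cast; ring
    rw [this, Real.cos_add_pi_div_two]; ring
  rw [h3]; exact h2

lemma dpsi_continuous (k j : ℕ) : Continuous (dpsi k j) :=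
  continuous_iff_continuousAt.2 fun x => (dpsi_hasDerivAt k j x).continuousAt

lemma dpsi_abs_le (k j : ℕ) (x : ℝ) : |dpsi k j x| ≤ Real.sqrt 2 * frq j ^ k := by
  unfold dpsi
  rw [abs_mul, abs_mul, abs_of_nonneg (ampl_nonneg j), abs_of_nonneg (pow_nonneg (frq_nonneg j) k)]
  have h1 := Real.abs_cos_le_one (frq j * x + phs j + k * (Real.pi / 2))
  have h2 := ampl_le j
  have h3 := pow_nonneg (frq_nonneg j) k
  calc _ ≤ ampl j * frq j ^ k * 1 := by
        apply mul_le_mul_of_nonneg_left h1; exact mul_nonneg (ampl_nonneg j) h3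
    _ ≤ _ := by rw [mul_one]; exact mul_le_mul_of_nonneg_right h2 h3

lemma dpsi_abs_le' (k j : ℕ) (x : ℝ) :
    |dpsi k j x| ≤ Real.sqrt 2 * Real.pi ^ k * ((j : ℝ) + 1) ^ k := by
  refine (dpsi_abs_le k j x).trans ?_
  rw [mul_assoc, ← mul_pow]
  gcongr
  · exact frq_nonneg j
  · exact frq_le j

lemma psi_abs_le (j : ℕ) (x : ℝ) : |fourierPsi (j + 1) x| ≤ Real.sqrt 2 := by
  rw [psi_eq]; simpa using dpsi_abs_le 0 j x

/-- integral of a cosine with integer frequency -/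
lemma int_cos (p : ℤ) (a : ℝ) :
    ∫ x in (0 : ℝ)..1, Real.cos (2 * Real.pi * p * x + a) = if p = 0 then Real.cos a else 0 := by
  split_ifs with h
  · subst h; simp
  · have hp : (2 * Real.pi * p : ℝ) ≠ 0 := by
      have : (p : ℝ) ≠ 0 := by exact_mod_cast h
      have := Real.pi_ne_zero
      positivity
    rw [intervalIntegral.integral_comp_mul_add (fun y => Real.cos y) hp, integral_cos]
    have : Real.sin (2 * Real.pi * p * 1 + a) = Real.sin a := by
      have := Real.sin_add_int_mul_two_pi a p
      rw [← this]; congr 1; ring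
    rw [this]; simp

lemma dpsi_orth (k i j : ℕ) :
    ∫ x in (0 : ℝ)..1, dpsi k i x * dpsi k j x = if i = j then frq j ^ (2 * k) else 0 := by
  set mi : ℤ := (((i + 1) / 2 : ℕ) : ℤ) with hmi
  set mj : ℤ := (((j + 1) / 2 : ℕ) : ℤ) with hmj
  have hfi : frq i = 2 * Real.pi * (mi : ℝ) := by rw [hmi, Int.cast_natCast]; rfl
  have hfj : frq j = 2 * Real.pi * (mj : ℝ) := by rw [hmj, Int.cast_natCast]; rfl
  have e : ∀ x : ℝ, dpsi k i x * dpsi k j x = (ampl i * ampl j * frq i ^ k * frq j ^ k / 2) *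
      (Real.cos (2 * Real.pi * ((mi - mj : ℤ) : ℝ) * x + (phs i - phs j)) +
       Real.cos (2 * Real.pi * ((mi + mj : ℤ) : ℝ) * x + (phs i + phs j + k * Real.pi))) := by
    intro x
    have e1 : 2 * Real.pi * ((mi - mj : ℤ) : ℝ) * x + (phs i - phs j) =
      (frq i * x + phs i + k * (Real.pi / 2)) - (frq j * x + phs j + k * (Real.pi / 2)) := by
      rw [hfi, hfj]; push_cast; ring
    have e2 : 2 * Real.pi * ((mi + mj : ℤ) : ℝ) * x + (phs i + phs j + k * Real.pi) =
      (frq i * x + phs i + k * (Real.pi / 2)) + (frq j * x + phs j + k * (Real.pi / 2)) := by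
      rw [hfi, hfj]; push_cast; ring
    rw [e1, e2, Real.cos_sub, Real.cos_add (frq i * x + phs i + k * (Real.pi / 2)) (frq j * x + phs j + k * (Real.pi / 2))]
    unfold dpsi; ring
  simp_rw [e]
  rw [intervalIntegral.integral_const_mul, intervalIntegral.integral_add
    (by apply Continuous.intervalIntegrable; fun_prop)
    (by apply Continuous.intervalIntegrable; fun_prop), int_cos, int_cos]
  by_cases hij : i = j
  · subst hij
    have : mi = mj := rfl
    simp only [this, sub_self, if_true, Real.cos_zero]
    rcases Nat.eq_zero_or_pos i with h | h
    · subst h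
      have h0 : mj = 0 := by simp [hmj]
      rcases Nat.eq_zero_or_pos k with hk | hk
      · subst hk; simp [h0, ampl, phs]; norm_num
      · simp [hfj, h0, hk.ne']
    · have h0 : mj + mj ≠ 0 := by omega
      have hs : ampl i * ampl i = 2 := by
        unfold ampl; rw [if_neg h.ne']; exact Real.mul_self_sqrt (by norm_num)
      rw [if_neg h0, hs]; ring
  · rw [if_neg hij]
    by_cases hm : mi = mj
    · have hne : ¬ (mi + mj = 0) := by omega
      rw [if_neg hne, if_pos (by omega)]
      have hc : Real.cos (phs i - phs j) = 0 := by
        unfold phs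
        by_cases h1 : (i + 1) % 2 = 0
        · have h2 : ¬ ((j + 1) % 2 = 0 ∨ j = 0) := by omega
          rw [if_pos (Or.inl h1), if_neg h2]; simp
        · have h2 : ((j + 1) % 2 = 0) := by omega
          have h3 : ¬ ((i + 1) % 2 = 0 ∨ i = 0) := by omega
          rw [if_pos (Or.inl h2), if_neg h3]; simp
      rw [hc]; simp
    · have h1 : ¬ (mi - mj = 0) := by omega
      have h2 : ¬ (mi + mj = 0) := by omega
      simp [h1, h2]

lemma iteratedDeriv_fourierFun (k : ℕ) (c : ℕ → ℝ)
    (hc : Summable fun j : ℕ => ((j : ℝ) + 1) ^ k * |c j|) :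
    iteratedDeriv k (fourierFun c) = fun x => ∑' j, c j * dpsi k j x := by
  have key : ∀ l ≤ k, Summable fun j : ℕ => Real.sqrt 2 * Real.pi ^ l * (((j : ℝ) + 1) ^ l * |c j|) := by
    intro l hl
    refine Summable.mul_left _ (Summable.of_nonneg_of_le (fun j => by positivity) (fun j => ?_) hc)
    gcongr
    linarith [Nat.cast_nonneg (α := ℝ) j]
  have bd : ∀ l j x, ‖c j * dpsi l j x‖ ≤ Real.sqrt 2 * Real.pi ^ l * (((j : ℝ) + 1) ^ l * |c j|) := by
    intro l j x
    rw [Real.norm_eq_abs, abs_mul]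
    calc _ ≤ |c j| * (Real.sqrt 2 * Real.pi ^ l * ((j : ℝ) + 1) ^ l) := by
          gcongr; exact dpsi_abs_le' l j x
      _ = _ := by ring
  have main : ∀ l ≤ k, iteratedDeriv l (fourierFun c) = fun x => ∑' j, c j * dpsi l j x := by
    intro l
    induction l with
    | zero =>
      intro _
      ext x
      simp [fourierFun, psi_eq]
    | succ l ih =>
      intro hl
      rw [iteratedDeriv_succ, ih (by omega)]
      ext x
      exact (hasDerivAt_tsum (key (l + 1) hl)
        (fun j y => (dpsi_hasDerivAt l j y).const_mul (c j)) (fun j y => bd (l + 1) j y)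
        (Summable.of_norm_bounded (key l (by omega)) (fun j => bd l j 0)) x).deriv
  exact main k le_rfl

lemma parseval (k : ℕ) (g : ℕ → ℝ) (hg : Summable fun j : ℕ => ((j : ℝ) + 1) ^ k * |g j|) :
    HasSum (fun j => g j ^ 2 * frq j ^ (2 * k))
      (∫ x in (0 : ℝ)..1, (∑' j, g j * dpsi k j x) ^ 2) := by
  set B : ℕ → ℝ := fun j => Real.sqrt 2 * Real.pi ^ k * (((j : ℝ) + 1) ^ k * |g j|) with hB
  have hBs : Summable B := hg.mul_left _
  have hB0 : ∀ j, 0 ≤ B j := fun j => by positivity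
  have bd : ∀ j x, ‖g j * dpsi k j x‖ ≤ B j := by
    intro j x
    rw [Real.norm_eq_abs, abs_mul]
    calc _ ≤ |g j| * (Real.sqrt 2 * Real.pi ^ k * ((j : ℝ) + 1) ^ k) := by
          gcongr; exact dpsi_abs_le' k j x
      _ = _ := by rw [hB]; ring
  have hsum : ∀ x, Summable fun j => ‖g j * dpsi k j x‖ := fun x =>
    Summable.of_nonneg_of_le (fun _ => norm_nonneg _) (fun j => bd j x) hBs
  have hsq : ∀ x, (∑' j, g j * dpsi k j x) ^ 2 =
      ∑' p : ℕ × ℕ, (g p.1 * dpsi k p.1 x) * (g p.2 * dpsi k p.2 x) := by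
    intro x
    rw [sq, tsum_mul_tsum_of_summable_norm (hsum x) (hsum x)]
  have hBB : Summable fun p : ℕ × ℕ => B p.1 * B p.2 := hBs.mul_of_nonneg hBs hB0 hB0
  have hcont : ∀ p : ℕ × ℕ, Continuous fun x => (g p.1 * dpsi k p.1 x) * (g p.2 * dpsi k p.2 x) :=
    fun p => (continuous_const.mul (dpsi_continuous k _)).mul
      (continuous_const.mul (dpsi_continuous k _))
  have h1 : HasSum (fun p : ℕ × ℕ => ∫ x in (0 : ℝ)..1,
        (g p.1 * dpsi k p.1 x) * (g p.2 * dpsi k p.2 x))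
      (∫ x in (0 : ℝ)..1, ∑' p : ℕ × ℕ, (g p.1 * dpsi k p.1 x) * (g p.2 * dpsi k p.2 x)) := by
    refine intervalIntegral.hasSum_integral_of_dominated_convergence
      (fun p _ => B p.1 * B p.2) (fun p => (hcont p).aestronglyMeasurable) ?_ ?_ ?_ ?_
    · intro p
      refine ae_of_all _ fun x _ => ?_
      rw [norm_mul]
      exact mul_le_mul (bd _ _) (bd _ _) (norm_nonneg _) (hB0 _)
    · exact ae_of_all _ fun x _ => hBB
    · simp
    · refine ae_of_all _ fun x _ => ?_
      exact (Summable.of_norm_bounded hBB (fun p => by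
        rw [norm_mul]
        exact mul_le_mul (bd _ _) (bd _ _) (norm_nonneg _) (hB0 _))).hasSum
  simp_rw [← hsq] at h1
  have h2 : ∀ p : ℕ × ℕ, (∫ x in (0 : ℝ)..1,
        (g p.1 * dpsi k p.1 x) * (g p.2 * dpsi k p.2 x)) =
        if p.1 = p.2 then g p.2 ^ 2 * frq p.2 ^ (2 * k) else 0 := by
    intro p
    have : ∀ x, (g p.1 * dpsi k p.1 x) * (g p.2 * dpsi k p.2 x) =
      (g p.1 * g p.2) * (dpsi k p.1 x * dpsi k p.2 x) := fun x => by ring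
    simp_rw [this]
    rw [intervalIntegral.integral_const_mul, dpsi_orth]
    split_ifs with h
    · rw [h]; ring
    · simp
  simp_rw [h2] at h1
  have hinj : Function.Injective (fun j : ℕ => (j, j)) := fun a b h => by simpa using h
  rw [← hinj.hasSum_iff] at h1
  · simpa [Function.comp_def] using h1
  · rintro ⟨a, b⟩ hab
    have : a ≠ b := by
      rintro rfl; exact hab ⟨a, rfl⟩
    simp [this]

open scoped ENNReal NNReal

noncomputable def gK : ℝ≥0∞ := ∫⁻ g, ENNReal.ofReal (Real.exp (g ^ 2 / 4)) ∂(gaussianReal 0 1)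

lemma gK_lt_top : gK < ⊤ := by
  unfold gK
  have h1 : gaussianReal 0 1 = volume.withDensity (gaussianPDF 0 1) :=
    gaussianReal_of_var_ne_zero 0 one_ne_zero
  rw [h1, lintegral_withDensity_eq_lintegral_mul _ (measurable_gaussianPDF 0 1)
    (by fun_prop)]
  have hi : Integrable (fun x : ℝ => (Real.sqrt (2 * Real.pi))⁻¹ * Real.exp (-(1 / 4) * x ^ 2)) :=
    (integrable_exp_neg_mul_sq (by norm_num : (0 : ℝ) < 1 / 4)).const_mul _
  have := hi.lintegral_lt_top
  refine lt_of_le_of_lt (le_of_eq ?_) this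
  congr 1
  ext x
  simp only [Pi.mul_apply, gaussianPDF, gaussianPDFReal]
  rw [← ENNReal.ofReal_mul (by positivity)]
  congr 1
  simp only [NNReal.coe_one, mul_one, sub_zero]
  rw [mul_assoc, ← Real.exp_add]
  congr 2
  ring

lemma lintegral_exp_gaussian (v : ℝ≥0) (t : ℝ) :
    ∫⁻ e, ENNReal.ofReal (Real.exp (t * e)) ∂(gaussianReal 0 v) =
      ENNReal.ofReal (Real.exp (v * t ^ 2 / 2)) := by
  rw [← ofReal_integral_eq_lintegral_ofReal (integrable_exp_mul_gaussianReal t)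
    (ae_of_all _ fun _ => (Real.exp_pos _).le)]
  have := congrFun (mgf_id_gaussianReal (μ := 0) (v := v)) t
  simp only [mgf, id, zero_mul, zero_add] at this
  rw [this]

lemma subG_sq {Ω : Type*} [MeasurableSpace Ω] (μ : Measure Ω) [IsProbabilityMeasure μ]
    (Z : Ω → ℝ) (hZ : Measurable Z) (c : ℝ≥0) (hc : 0 < c) (h : HasSubgaussianMGF Z c μ) :
    ∫⁻ ω, ENNReal.ofReal (Real.exp (Z ω ^ 2 / (4 * c))) ∂μ ≤ gK := by
  have hc' : (0 : ℝ) < c := by exact_mod_cast hc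
  set τ : ℝ := (Real.sqrt (2 * c))⁻¹ with hτ
  have hτ2 : τ ^ 2 = 1 / (2 * c) := by
    rw [hτ, inv_pow, Real.sq_sqrt (by positivity), one_div]
  have e1 : ∀ ω, ENNReal.ofReal (Real.exp (Z ω ^ 2 / (4 * c))) =
      ∫⁻ g, ENNReal.ofReal (Real.exp ((τ * Z ω) * g)) ∂(gaussianReal 0 1) := by
    intro ω
    rw [lintegral_exp_gaussian, mul_pow, hτ2]
    congr 2
    simp only [NNReal.coe_one]
    field_simp
    norm_num
  simp_rw [e1]
  rw [lintegral_lintegral_swap (by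
    apply Measurable.aemeasurable
    unfold Function.uncurry
    fun_prop)]
  unfold gK
  refine lintegral_mono fun g => ?_
  have h2 : ∀ ω, τ * Z ω * g = (τ * g) * Z ω := fun ω => by ring
  simp_rw [h2]
  rw [← ofReal_integral_eq_lintegral_ofReal (h.integrable_exp_mul _)
    (ae_of_all _ fun _ => (Real.exp_pos _).le)]
  apply ENNReal.ofReal_le_ofReal
  refine (h.mgf_le (τ * g)).trans (le_of_eq ?_)
  rw [mul_pow, hτ2]
  congr 1
  field_simp
  ring

lemma subG_of_lintegral {Ω : Type*} [MeasurableSpace Ω] (μ : Measure Ω) 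
    (Z : Ω → ℝ) (hZ : Measurable Z) (c : ℝ≥0)
    (h : ∀ t : ℝ, ∫⁻ ω, ENNReal.ofReal (Real.exp (t * Z ω)) ∂μ ≤
      ENNReal.ofReal (Real.exp (c * t ^ 2 / 2))) : HasSubgaussianMGF Z c μ := by
  have hi : ∀ t : ℝ, Integrable (fun ω => Real.exp (t * Z ω)) μ := by
    intro t
    refine ⟨by fun_prop, ?_⟩
    rw [hasFiniteIntegral_iff_ofReal (ae_of_all _ fun _ => (Real.exp_pos _).le)]
    exact (h t).trans_lt ENNReal.ofReal_lt_top
  refine ⟨hi, fun t => ?_⟩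
  unfold mgf
  rw [← ENNReal.ofReal_le_ofReal_iff (Real.exp_pos _).le,
    ofReal_integral_eq_lintegral_ofReal (hi t) (ae_of_all _ fun _ => (Real.exp_pos _).le)]
  exact h t

lemma conc {ι Ω : Type*} [Countable ι] [MeasurableSpace Ω] (μ : Measure Ω)
    (w : ι → ℝ) (Z : ι → Ω → ℝ) (W s L : ℝ) (K : ℝ≥0∞) (hw0 : ∀ a, 0 ≤ w a) (hws : Summable w)
    (hW : ∑' a, w a ≤ W) (hW0 : 0 < W) (hL : 0 ≤ L)
    (hZ : ∀ a, Measurable (Z a))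
    (hK : ∀ a, ∫⁻ ω, ENNReal.ofReal (Real.exp (s * Z a ω ^ 2)) ∂μ ≤ K)
    (hsum : ∀ ω, Summable fun a => w a * Z a ω ^ 2) :
    μ {ω | W * (L + 1) ≤ s * ∑' a, w a * Z a ω ^ 2} ≤ K * ENNReal.ofReal (Real.exp (-L)) := by
  set F : Ω → ℝ≥0∞ := fun ω => ∑' a, ENNReal.ofReal (w a / W * Real.exp (-L)) *
    ENNReal.ofReal (Real.exp (s * Z a ω ^ 2)) with hF
  have hsub : {ω | W * (L + 1) ≤ s * ∑' a, w a * Z a ω ^ 2} ⊆ {ω | 1 ≤ F ω} := by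
    intro ω hω
    simp only [Set.mem_ofPred_eq] at hω ⊢
    by_cases htop : F ω = ⊤
    · rw [htop]; exact le_top
    have hn : ∀ a, 0 ≤ w a / W * Real.exp (-L) * Real.exp (s * Z a ω ^ 2) := fun a => by
      have := hw0 a; positivity
    have hF' : F ω = ∑' a, ENNReal.ofReal (w a / W * Real.exp (-L) * Real.exp (s * Z a ω ^ 2)) := by
      rw [hF]
      refine tsum_congr fun a => ?_
      rw [← ENNReal.ofReal_mul (by have := hw0 a; positivity)]
    have hs : Summable fun a => w a / W * Real.exp (-L) * Real.exp (s * Z a ω ^ 2) := by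
      have := ENNReal.summable_toReal (hF' ▸ htop)
      refine this.congr fun a => ?_
      rw [ENNReal.toReal_ofReal (hn a)]
    rw [hF', ← ENNReal.ofReal_tsum_of_nonneg hn hs, ENNReal.one_le_ofReal]
    have hs2 : Summable fun a => (s / W) * (w a * Z a ω ^ 2) - (L / W) * w a :=
      ((hsum ω).mul_left _).sub (hws.mul_left _)
    have hle : ∑' a, ((s / W) * (w a * Z a ω ^ 2) - (L / W) * w a) ≤
        ∑' a, w a / W * Real.exp (-L) * Real.exp (s * Z a ω ^ 2) := by
      refine hs2.tsum_le_tsum (fun a => ?_) hs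
      have := Real.add_one_le_exp (-L + s * Z a ω ^ 2)
      rw [mul_assoc, ← Real.exp_add]
      have hwa : 0 ≤ w a / W := div_nonneg (hw0 a) hW0.le
      calc _ = w a / W * (-L + s * Z a ω ^ 2) := by field_simp; ring
        _ ≤ _ := by gcongr; linarith
    refine le_trans ?_ hle
    rw [((hsum ω).mul_left _).tsum_sub (hws.mul_left _), tsum_mul_left, tsum_mul_left]
    have h1 : L / W * ∑' a, w a ≤ L := by
      calc _ ≤ L / W * W := by gcongr
        _ = L := by field_simp
    have h2 : L + 1 ≤ s / W * ∑' a, w a * Z a ω ^ 2 := by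
      rw [div_mul_eq_mul_div, le_div_iff₀ hW0]; linarith
    linarith
  refine (measure_mono hsub).trans ?_
  have hm : AEMeasurable F μ := by
    apply Measurable.aemeasurable
    rw [hF]
    refine Measurable.tsum fun a => ?_
    have := hZ a
    fun_prop
  have hmk := mul_meas_ge_le_lintegral₀ hm 1
  rw [one_mul] at hmk
  refine hmk.trans ?_
  rw [hF, lintegral_tsum (fun a => by have := hZ a; fun_prop)]
  have : ∀ a, ∫⁻ ω, ENNReal.ofReal (w a / W * Real.exp (-L)) *
    ENNReal.ofReal (Real.exp (s * Z a ω ^ 2)) ∂μ ≤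
      ENNReal.ofReal (w a / W * Real.exp (-L)) * K := by
    intro a
    rw [lintegral_const_mul _ (by have := hZ a; fun_prop)]
    gcongr
    exact hK a
  refine (ENNReal.tsum_le_tsum this).trans ?_
  rw [ENNReal.tsum_mul_right, mul_comm,
    ← ENNReal.ofReal_tsum_of_nonneg (fun a => by have := hw0 a; positivity)
      ((hws.div_const _).mul_right _)]
  gcongr
  rw [tsum_mul_right, tsum_div_const]
  have : (∑' a, w a) / W ≤ 1 := (div_le_one hW0).2 hW
  nlinarith [Real.exp_pos (-L)]

noncomputable def baseM (σ : ℝ) : Measure (ℝ × ℝ) :=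
  (volume.restrict (Set.Icc (0 : ℝ) 1)).prod (gaussianReal 0 (Real.toNNReal (σ ^ 2)))

instance unifProb : IsProbabilityMeasure (volume.restrict (Set.Icc (0 : ℝ) 1)) := ⟨by simp⟩

instance (σ : ℝ) : IsProbabilityMeasure (baseM σ) := by unfold baseM; infer_instance

instance (σ : ℝ) (n : ℕ) : IsProbabilityMeasure (regressionData σ n) := by
  unfold regressionData; infer_instance

lemma mean_sq (σ : ℝ) (n : ℕ) (hn : 0 < n) (ξ : ℝ × ℝ → ℝ) (hξ : Measurable ξ) (c : ℝ≥0)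
    (hc : 0 < c) (h : HasSubgaussianMGF ξ c (baseM σ)) :
    ∫⁻ ω, ENNReal.ofReal (Real.exp (n / (4 * c) * ((1 / (n : ℝ)) * ∑ i, ξ (ω i)) ^ 2))
      ∂(regressionData σ n) ≤ gK := by
  have hind : iIndepFun (fun (i : Fin n) (ω : Fin n → ℝ × ℝ) => ξ (ω i)) (regressionData σ n) := by
    have := iIndepFun_pi (ι := Fin n) (μ := fun _ => baseM σ) (X := fun _ => ξ)
      (fun i => hξ.aemeasurable)
    exact this
  have hsub : ∀ i ∈ (Finset.univ : Finset (Fin n)),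
      HasSubgaussianMGF (fun (ω : Fin n → ℝ × ℝ) => ξ (ω i)) c (regressionData σ n) := by
    intro i _
    have hmp : MeasurePreserving (Function.eval i) (regressionData σ n) (baseM σ) :=
      measurePreserving_eval (fun _ : Fin n => baseM σ) i
    have h' := h
    rw [← hmp.map_eq] at h'
    exact HasSubgaussianMGF.of_map hmp.measurable.aemeasurable h'
  have hS := HasSubgaussianMGF.sum_of_iIndepFun hind hsub
  have hmeas : Measurable fun ω : Fin n → ℝ × ℝ => ∑ i, ξ (ω i) :=
    Finset.measurable_sum _ fun i _ => hξ.comp (measurable_pi_apply i)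
  have hcn : ∑ i ∈ (Finset.univ : Finset (Fin n)), c = (n : ℝ≥0) * c := by simp
  rw [hcn] at hS
  have := subG_sq _ _ hmeas (n * c) (by positivity) hS
  refine le_trans (le_of_eq ?_) this
  congr 1
  ext ω
  congr 2
  have hc' : (0 : ℝ) < c := by exact_mod_cast hc
  have hn' : (0 : ℝ) < n := by exact_mod_cast hn
  push_cast
  field_simp

lemma noise_subG (σ : ℝ) (φ : ℝ → ℝ) (hφ : Measurable φ) (hb : ∀ x, φ x ^ 2 ≤ 2) :
    HasSubgaussianMGF (fun p : ℝ × ℝ => p.2 * φ p.1) (Real.toNNReal (2 * σ ^ 2)) (baseM σ) := by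
  refine subG_of_lintegral _ _ (by fun_prop) _ fun t => ?_
  unfold baseM
  rw [lintegral_prod _ (by fun_prop)]
  have : ∀ x, ∫⁻ y, ENNReal.ofReal (Real.exp (t * (y * φ x)))
      ∂(gaussianReal 0 (Real.toNNReal (σ ^ 2))) ≤
      ENNReal.ofReal (Real.exp ((Real.toNNReal (2 * σ ^ 2)) * t ^ 2 / 2)) := by
    intro x
    have e : ∀ y, t * (y * φ x) = (t * φ x) * y := fun y => by ring
    simp_rw [e]
    rw [lintegral_exp_gaussian]
    apply ENNReal.ofReal_le_ofReal
    apply Real.exp_le_exp.2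
    rw [Real.coe_toNNReal _ (by positivity), Real.coe_toNNReal _ (by positivity), mul_pow]
    have := mul_le_mul_of_nonneg_left (hb x) (by positivity : 0 ≤ σ ^ 2 * t ^ 2)
    nlinarith
  refine (lintegral_mono this).trans ?_
  simp

lemma design_subG (σ : ℝ) (φ : ℝ → ℝ) (hφ : Continuous φ) (hb : ∀ x, |φ x| ≤ 2) (m : ℝ)
    (hm : ∫ x in (0 : ℝ)..1, φ x = m) :
    HasSubgaussianMGF (fun p : ℝ × ℝ => φ p.1 - m) 4 (baseM σ) := by
  have := hasSubgaussianMGF_of_mem_Icc (μ := baseM σ) (X := fun p : ℝ × ℝ => φ p.1) (a := -2) (b := 2)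
    (by fun_prop) (ae_of_all _ fun p => abs_le.1 (hb p.1))
  have e : ∫ p, φ p.1 ∂(baseM σ) = m := by
    unfold baseM
    rw [← hm, intervalIntegral.integral_of_le zero_le_one, ← integral_Icc_eq_integral_Ioc]
    rw [integral_fun_fst φ]
    simp
  rw [e] at this
  convert this using 1
  ext
  norm_num

lemma seq_ineq (n : ℕ) (hn : 0 < n) (lam : ℝ) (hlam : 0 < lam) (κ : ℕ → ℝ) (hκ : ∀ j, 1 ≤ κ j)
    (p : ℕ → Fin n → ℝ) (hp : ∀ j i, |p j i| ≤ Real.sqrt 2) (ε : Fin n → ℝ) (f b g : ℕ → ℝ)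
    (hg : ∀ j, g j = b j - f j) (hgs : Summable fun j => |g j|)
    (hfs : Summable fun j => κ j * f j ^ 2) (hbs : Summable fun j => κ j * b j ^ 2)
    (v : ℕ → ℝ) (hv : ∀ j, v j = (1 + lam * κ j)⁻¹) (hvs : Summable v)
    (heq : ∀ j, lam * κ j * b j = (1 / (n : ℝ)) * ∑ i, (ε i - ∑' l, g l * p l i) * p j i)
    (hHS : ∑' q : ℕ × ℕ, v q.1 * v q.2 * ((1 / (n : ℝ)) * ∑ i, (p q.1 i * p q.2 i -
      (if q.1 = q.2 then 1 else 0))) ^ 2 ≤ 1 / 4) :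
    Summable (fun j => (1 + lam * κ j) * g j ^ 2) ∧
    ∑' j, (1 + lam * κ j) * g j ^ 2 ≤ 8 * (lam * ∑' j, κ j * f j ^ 2 +
      ∑' j, v j * ((1 / (n : ℝ)) * ∑ i, ε i * p j i) ^ 2) := by
  have hn' : (0 : ℝ) < n := by exact_mod_cast hn
  have hs2 : Real.sqrt 2 * Real.sqrt 2 = 2 := Real.mul_self_sqrt (by norm_num)
  have hκ0 : ∀ j, 0 < κ j := fun j => by linarith [hκ j]
  have hd : ∀ j, 0 < 1 + lam * κ j := fun j => by have := mul_pos hlam (hκ0 j); linarith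
  have hv0 : ∀ j, 0 < v j := fun j => by rw [hv]; exact inv_pos.2 (hd j)
  set ν : ℕ → ℝ := fun j => (1 / (n : ℝ)) * ∑ i, ε i * p j i with hν
  set E : ℕ × ℕ → ℝ := fun q => (1 / (n : ℝ)) * ∑ i, (p q.1 i * p q.2 i -
      (if q.1 = q.2 then 1 else 0)) with hE
  set G : Fin n → ℝ := fun i => ∑' l, g l * p l i with hG
  -- boundedness
  have hνb : ∀ j, |ν j| ≤ (1 / (n : ℝ)) * ∑ i, |ε i| * Real.sqrt 2 := by
    intro j
    simp only [hν]
    rw [abs_mul, abs_of_pos (by positivity : 0 < 1 / (n : ℝ))]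
    gcongr
    refine (Finset.abs_sum_le_sum_abs _ _).trans (Finset.sum_le_sum fun i _ => ?_)
    rw [abs_mul]; gcongr; exact hp j i
  set B0 := (1 / (n : ℝ)) * ∑ i, |ε i| * Real.sqrt 2 with hB0
  have hB00 : 0 ≤ B0 := (abs_nonneg _).trans (hνb 0)
  have hEb : ∀ q, |E q| ≤ 3 := by
    intro q
    simp only [hE]
    rw [abs_mul, abs_of_pos (by positivity : 0 < 1 / (n : ℝ))]
    have : |∑ i, (p q.1 i * p q.2 i - (if q.1 = q.2 then (1 : ℝ) else 0))| ≤ ∑ i : Fin n, (3 : ℝ) := by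
      refine (Finset.abs_sum_le_sum_abs _ _).trans (Finset.sum_le_sum fun i _ => ?_)
      have h1 : |p q.1 i * p q.2 i| ≤ 2 := by
        rw [abs_mul, ← hs2]
        exact mul_le_mul (hp _ _) (hp _ _) (abs_nonneg _) (Real.sqrt_nonneg _)
      have h2 : |(if q.1 = q.2 then (1 : ℝ) else 0)| ≤ 1 := by split_ifs <;> simp
      refine (abs_sub _ _).trans ?_
      linarith
    calc _ ≤ 1 / (n : ℝ) * ∑ i : Fin n, (3 : ℝ) := by gcongr
      _ = 3 := by simp; field_simp
  -- summability
  have hκg : Summable fun j => κ j * g j ^ 2 := by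
    refine Summable.of_nonneg_of_le (fun j => by have := hκ0 j; positivity) (fun j => ?_)
      ((hbs.add hfs).mul_left 2)
    rw [hg]
    have : (b j - f j) ^ 2 ≤ 2 * (b j ^ 2 + f j ^ 2) := by nlinarith [sq_nonneg (b j + f j)]
    nlinarith [mul_le_mul_of_nonneg_left this (hκ0 j).le]
  have hg2 : Summable fun j => g j ^ 2 := by
    refine Summable.of_nonneg_of_le (fun j => by positivity) (fun j => ?_) hκg
    nlinarith [mul_le_mul_of_nonneg_right (hκ j) (sq_nonneg (g j))]
  set Q : ℕ → ℝ := fun j => (1 + lam * κ j) * g j ^ 2 with hQ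
  have hQ0 : ∀ j, 0 ≤ Q j := fun j => mul_nonneg (hd j).le (sq_nonneg _)
  have hQs : Summable Q := by
    have := hg2.add (hκg.mul_left lam)
    refine this.congr fun j => ?_
    simp only [hQ]; ring
  refine ⟨hQs, ?_⟩
  have hκfg : Summable fun j => κ j * f j * g j := by
    refine Summable.of_norm_bounded (hfs.add hκg) fun j => ?_
    rw [Real.norm_eq_abs, abs_mul, abs_mul, abs_of_pos (hκ0 j)]
    have : |f j| * |g j| ≤ f j ^ 2 + g j ^ 2 := by
      rw [← sq_abs (f j), ← sq_abs (g j)]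
      nlinarith [sq_nonneg (|f j| - |g j|), sq_nonneg (|f j|), sq_nonneg (|g j|)]
    nlinarith [mul_le_mul_of_nonneg_left this (hκ0 j).le]
  have hνg : Summable fun j => ν j * g j := by
    refine Summable.of_norm_bounded (hgs.mul_left B0) fun j => ?_
    rw [Real.norm_eq_abs, abs_mul]
    exact mul_le_mul_of_nonneg_right (hνb j) (abs_nonneg _)
  have hvν : Summable fun j => v j * ν j ^ 2 := by
    refine Summable.of_nonneg_of_le (fun j => mul_nonneg (hv0 j).le (sq_nonneg _)) (fun j => ?_)
      (hvs.mul_right (B0 ^ 2))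
    apply mul_le_mul_of_nonneg_left _ (hv0 j).le
    exact sq_le_sq' (by linarith [abs_le.1 (hνb j)]) (abs_le.1 (hνb j)).2
  have hvv : Summable fun q : ℕ × ℕ => v q.1 * v q.2 :=
    hvs.mul_of_nonneg hvs (fun j => (hv0 j).le) (fun j => (hv0 j).le)
  have hgg : Summable fun q : ℕ × ℕ => |g q.1| * |g q.2| :=
    hgs.mul_of_nonneg hgs (fun j => abs_nonneg _) (fun j => abs_nonneg _)
  have hQQ : Summable fun q : ℕ × ℕ => Q q.1 * Q q.2 := hQs.mul_of_nonneg hQs hQ0 hQ0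
  have hvE : Summable fun q : ℕ × ℕ => v q.1 * v q.2 * E q ^ 2 := by
    refine Summable.of_nonneg_of_le
      (fun q => mul_nonneg (mul_pos (hv0 _) (hv0 _)).le (sq_nonneg _)) (fun q => ?_)
      (hvv.mul_right (3 ^ 2))
    apply mul_le_mul_of_nonneg_left _ (mul_pos (hv0 _) (hv0 _)).le
    exact sq_le_sq' (by linarith [abs_le.1 (hEb q)]) (abs_le.1 (hEb q)).2
  have hggE : Summable fun q : ℕ × ℕ => g q.1 * g q.2 * E q := by
    refine Summable.of_norm_bounded (hgg.mul_right 3) fun q => ?_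
    rw [Real.norm_eq_abs, abs_mul, abs_mul]
    exact mul_le_mul_of_nonneg_left (hEb q) (by positivity)
  have hgp : ∀ i, Summable fun l => ‖g l * p l i‖ := by
    intro i
    refine Summable.of_nonneg_of_le (fun _ => norm_nonneg _) (fun l => ?_)
      (hgs.mul_right (Real.sqrt 2))
    rw [Real.norm_eq_abs, abs_mul]
    exact mul_le_mul_of_nonneg_left (hp _ _) (abs_nonneg _)
  -- the empirical norm
  have hGsq : ∀ i, HasSum (fun q : ℕ × ℕ => (g q.1 * p q.1 i) * (g q.2 * p q.2 i)) (G i ^ 2) := by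
    intro i
    have h1 := summable_mul_of_summable_norm (hgp i) (hgp i)
    have h2 := tsum_mul_tsum_of_summable_norm (hgp i) (hgp i)
    have h3 := h1.hasSum
    rw [← h2, ← sq] at h3
    exact h3
  have hPn : HasSum (fun q : ℕ × ℕ => g q.1 * g q.2 * ((1 / (n : ℝ)) * ∑ i, p q.1 i * p q.2 i))
      ((1 / (n : ℝ)) * ∑ i, G i ^ 2) := by
    have h1 := (hasSum_sum (s := Finset.univ) fun i _ => hGsq i).mul_left (1 / (n : ℝ))
    refine h1.congr_fun ?_ |> fun h => h
    intro q
    rw [mul_left_comm]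
    congr 1
    rw [Finset.mul_sum]
    exact Finset.sum_congr rfl fun i _ => by ring
  have hdiag : HasSum (fun q : ℕ × ℕ => if q.1 = q.2 then g q.1 ^ 2 else 0) (∑' j, g j ^ 2) := by
    have hinj : Function.Injective (fun j : ℕ => (j, j)) := fun a b h => by simpa using h
    rw [← hinj.hasSum_iff]
    · simpa [Function.comp_def] using hg2.hasSum
    · rintro ⟨a, b⟩ hab
      have : a ≠ b := by
        rintro rfl; exact hab ⟨a, rfl⟩
      simp [this]
  have hPn2 : (1 / (n : ℝ)) * ∑ i, G i ^ 2 = ∑' q : ℕ × ℕ, g q.1 * g q.2 * E q + ∑' j, g j ^ 2 := by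
    refine hPn.unique ?_
    have := hggE.hasSum.add hdiag
    refine this.congr_fun ?_ |> fun h => h
    intro q
    simp only [hE]
    rw [Finset.sum_sub_distrib]
    split_ifs with h
    · rw [h]
      simp only [Finset.sum_const, Finset.card_univ, Fintype.card_fin, nsmul_eq_mul]
      field_simp
      ring
    · simp
  -- the normal equation summed
  have hterm : ∀ j, lam * (κ j * g j ^ 2) = -(lam * (κ j * f j * g j)) + ν j * g j -
      (1 / (n : ℝ)) * ∑ i, G i * (g j * p j i) := by
    intro j
    have h1 := heq j
    have h2 : (1 / (n : ℝ)) * ∑ i, (ε i - G i) * p j i = ν j - (1 / (n : ℝ)) * ∑ i, G i * p j i := by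
      simp only [hν]
      rw [← mul_sub, ← Finset.sum_sub_distrib]
      congr 1
      exact Finset.sum_congr rfl fun i _ => by ring
    have h3 : ∑ i, G i * (g j * p j i) = g j * ∑ i, G i * p j i := by
      rw [Finset.mul_sum]; exact Finset.sum_congr rfl fun i _ => by ring
    rw [h2] at h1
    rw [h3]
    have h4 : lam * (κ j * g j ^ 2) = (lam * κ j * b j) * g j - lam * (κ j * f j * g j) := by
      rw [hg]; ring
    rw [h4, h1]; ring
  have hlast : HasSum (fun j => (1 / (n : ℝ)) * ∑ i, G i * (g j * p j i))
      ((1 / (n : ℝ)) * ∑ i, G i ^ 2) := by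
    refine HasSum.mul_left _ (hasSum_sum fun i _ => ?_)
    rw [sq]
    exact ((hgp i).of_norm.hasSum).mul_left (G i)
  have hmain : lam * ∑' j, κ j * g j ^ 2 = -(lam * ∑' j, κ j * f j * g j) + ∑' j, ν j * g j -
      (1 / (n : ℝ)) * ∑ i, G i ^ 2 := by
    refine (hκg.hasSum.mul_left lam).unique ?_
    simp_rw [hterm]
    exact ((hκfg.hasSum.mul_left lam).neg.add hνg.hasSum).sub hlast
  have hG2 : ∑' j, Q j = ∑' j, g j ^ 2 + lam * ∑' j, κ j * g j ^ 2 := by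
    refine hQs.hasSum.unique ?_
    have := hg2.hasSum.add (hκg.hasSum.mul_left lam)
    refine this.congr_fun ?_ |> fun h => h
    intro j
    simp only [hQ]; ring
  -- bounds
  have hb1 : -(lam * ∑' j, κ j * f j * g j) + ∑' j, ν j * g j ≤
      2 * (lam * ∑' j, κ j * f j ^ 2) + 2 * ∑' j, v j * ν j ^ 2 + (1 / 4) * ∑' j, Q j := by
    refine hasSum_le (fun j => ?_) ((hκfg.hasSum.mul_left lam).neg.add hνg.hasSum)
      ((((hfs.hasSum.mul_left lam).mul_left 2).add (hvν.hasSum.mul_left 2)).add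
        (hQs.hasSum.mul_left (1 / 4)))
    have h1 : -(lam * (κ j * f j * g j)) ≤ 2 * (lam * (κ j * f j ^ 2)) + (1 / 8) * Q j := by
      have ha : 0 ≤ (lam * κ j) * (4 * f j + g j) ^ 2 :=
        mul_nonneg (mul_pos hlam (hκ0 j)).le (sq_nonneg _)
      have hb : lam * κ j * g j ^ 2 ≤ Q j := by
        simp only [hQ]; nlinarith [sq_nonneg (g j)]
      nlinarith
    have h2 : ν j * g j ≤ 2 * (v j * ν j ^ 2) + (1 / 8) * Q j := by
      have ha : 0 ≤ v j * (4 * ν j - (1 + lam * κ j) * g j) ^ 2 :=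
        mul_nonneg (hv0 j).le (sq_nonneg _)
      have hb : v j * (1 + lam * κ j) = 1 := by rw [hv]; exact inv_mul_cancel₀ (hd j).ne'
      have hc : v j * (4 * ν j - (1 + lam * κ j) * g j) ^ 2 = 16 * (v j * ν j ^ 2)
        - 8 * (v j * (1 + lam * κ j)) * (ν j * g j) +
          (v j * (1 + lam * κ j)) * Q j := by simp only [hQ]; ring
      rw [hc, hb] at ha
      linarith
    linarith
  have hQt0 : 0 ≤ ∑' j, Q j := tsum_nonneg hQ0
  have hR0 : 0 ≤ ∑' j, κ j * f j ^ 2 := tsum_nonneg fun j => mul_nonneg (hκ0 j).le (sq_nonneg _)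
  have hN0 : 0 ≤ ∑' j, v j * ν j ^ 2 := tsum_nonneg fun j => mul_nonneg (hv0 j).le (sq_nonneg _)
  rcases hQt0.eq_or_lt with h0 | hpos
  · rw [← h0]; have := mul_nonneg hlam.le hR0; linarith
  have hb2 : -(∑' q : ℕ × ℕ, g q.1 * g q.2 * E q) ≤ (1 / 2) * ∑' j, Q j := by
    set T := ∑' j, Q j with hT
    have hTT : HasSum (fun q : ℕ × ℕ => Q q.1 * Q q.2) (T * T) := by
      have h2 := hQs.tsum_mul_tsum hQs hQQ
      rw [hT, h2]; exact hQQ.hasSum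
    have h1 : -(∑' q : ℕ × ℕ, g q.1 * g q.2 * E q) ≤ (1 / (4 * T)) * (T * T) +
        T * ∑' q : ℕ × ℕ, v q.1 * v q.2 * E q ^ 2 := by
      refine hasSum_le (fun q => ?_) hggE.hasSum.neg
        ((hTT.mul_left (1 / (4 * T))).add (hvE.hasSum.mul_left T))
      have hb : v q.1 * (1 + lam * κ q.1) = 1 := by rw [hv]; exact inv_mul_cancel₀ (hd _).ne'
      have hb' : v q.2 * (1 + lam * κ q.2) = 1 := by rw [hv]; exact inv_mul_cancel₀ (hd _).ne'
      have hQQe : (Q q.1 * Q q.2) * (v q.1 * v q.2) = (g q.1 * g q.2) ^ 2 := by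
        simp only [hQ]
        calc _ = (v q.1 * (1 + lam * κ q.1)) * (v q.2 * (1 + lam * κ q.2)) *
            (g q.1 * g q.2) ^ 2 := by ring
          _ = _ := by rw [hb, hb']; ring
      set A := Q q.1 * Q q.2
      set V := v q.1 * v q.2 with hV
      set x := g q.1 * g q.2
      have hVp : 0 < V := mul_pos (hv0 _) (hv0 _)
      have hA : A = x ^ 2 / V := by rw [← hQQe]; field_simp
      rw [hA]
      have : 1 / (4 * T) * (x ^ 2 / V) + T * (V * E q ^ 2) - -(x * E q) =
        (x + 2 * T * V * E q) ^ 2 / (4 * T * V) := by field_simp; ring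
      have h3 : 0 ≤ (x + 2 * T * V * E q) ^ 2 / (4 * T * V) := by positivity
      linarith
    have h4 : (1 / (4 * T)) * (T * T) = T / 4 := by field_simp
    have h5 : T * ∑' q : ℕ × ℕ, v q.1 * v q.2 * E q ^ 2 ≤ T * (1 / 4) :=
      mul_le_mul_of_nonneg_left hHS hpos.le
    linarith
  rw [hPn2] at hmain
  linarith

lemma kap_pos (α : ℝ) (j : ℕ) : 0 < ((j : ℝ) + 1) ^ α := by positivity

lemma summable_succ_rpow {a : ℝ} (ha : a < -1) : Summable fun j : ℕ => ((j : ℝ) + 1) ^ a := by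
  have := (summable_nat_add_iff 1).2 (Real.summable_nat_rpow.2 ha)
  simpa using this

lemma polyKernel_sum (α : ℝ) (hα : 1 / 2 < α) (n : ℕ) (X u : Fin n → ℝ) (x : ℝ) :
    ∑ i, u i * polyKernel α x (X i) =
      fourierFun (fun j => ((j : ℝ) + 1) ^ (-(2 * α)) * ∑ i, u i * fourierPsi (j + 1) (X i)) x := by
  have hs : ∀ y, Summable fun j : ℕ =>
      ((j : ℝ) + 1) ^ (-(2 * α)) * fourierPsi (j + 1) x * fourierPsi (j + 1) y := by
    intro y
    refine Summable.of_norm_bounded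
      ((summable_succ_rpow (by linarith : -(2 * α) < -1)).mul_right 2) fun j => ?_
    rw [norm_mul, norm_mul, Real.norm_eq_abs, Real.norm_eq_abs, Real.norm_eq_abs,
      abs_of_pos (kap_pos _ j), mul_assoc]
    gcongr
    rw [← Real.mul_self_sqrt (by norm_num : (0 : ℝ) ≤ 2)]
    exact mul_le_mul (psi_abs_le _ _) (psi_abs_le _ _) (abs_nonneg _) (Real.sqrt_nonneg _)
  unfold polyKernel fourierFun
  simp_rw [← tsum_mul_left]
  rw [← Summable.tsum_finsetSum (fun i _ => (hs (X i)).mul_left (u i))]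
  refine tsum_congr fun j => ?_
  rw [Finset.mul_sum, Finset.sum_mul]
  exact Finset.sum_congr rfl fun i _ => by ring

lemma polyKernel_symm (α x y : ℝ) : polyKernel α x y = polyKernel α y x := by
  unfold polyKernel
  exact tsum_congr fun j => by ring

lemma coef_bd (α : ℝ) (n : ℕ) (X u : Fin n → ℝ) (j : ℕ) :
    |((j : ℝ) + 1) ^ (-(2 * α)) * ∑ i, u i * fourierPsi (j + 1) (X i)| ≤
      ((j : ℝ) + 1) ^ (-(2 * α)) * ∑ i, |u i| * Real.sqrt 2 := by
  rw [abs_mul, abs_of_pos (kap_pos _ j)]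
  gcongr
  refine (Finset.abs_sum_le_sum_abs _ _).trans (Finset.sum_le_sum fun i _ => ?_)
  rw [abs_mul]
  gcongr
  exact psi_abs_le _ _

lemma kernel_isUnit (α : ℝ) (hα : 1 / 2 < α) (n : ℕ) (X : Fin n → ℝ) (c : ℝ) (hc : 0 < c) :
    IsUnit ((Matrix.of fun (i j : Fin n) => polyKernel α (X i) (X j)) +
        c • (1 : Matrix (Fin n) (Fin n) ℝ)) := by
  rw [← Matrix.mulVec_injective_iff_isUnit, ← Matrix.coe_mulVecLin, injective_iff_map_eq_zero]
  intro u hu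
  rw [Matrix.mulVecLin_apply, Matrix.add_mulVec, Matrix.smul_mulVec, Matrix.one_mulVec] at hu
  have h1 : ∀ i, ∑ l, u l * polyKernel α (X i) (X l) + c * u i = 0 := by
    intro i
    have := congrFun hu i
    simp only [Pi.add_apply, Pi.smul_apply, smul_eq_mul, Pi.zero_apply, Matrix.mulVec, dotProduct,
      Matrix.of_apply] at this
    rw [← this]
    congr 1
    exact Finset.sum_congr rfl fun l _ => by ring
  have h2 : ∑ i, u i * ∑ l, u l * polyKernel α (X i) (X l) + c * ∑ i, u i ^ 2 = 0 := by
    rw [Finset.mul_sum, ← Finset.sum_add_distrib]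
    refine Finset.sum_eq_zero fun i _ => ?_
    have := h1 i
    linear_combination u i * this
  have h3 : 0 ≤ ∑ i, u i * ∑ l, u l * polyKernel α (X i) (X l) := by
    simp_rw [polyKernel_sum α hα n X u]
    unfold fourierFun
    simp_rw [← tsum_mul_left]
    rw [← Summable.tsum_finsetSum (fun i _ => ?_)]
    · refine tsum_nonneg fun j => ?_
      have : ∑ i, u i * (((j : ℝ) + 1) ^ (-(2 * α)) * (∑ i, u i * fourierPsi (j + 1) (X i)) *
          fourierPsi (j + 1) (X i)) =
          ((j : ℝ) + 1) ^ (-(2 * α)) * (∑ i, u i * fourierPsi (j + 1) (X i)) ^ 2 := by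
        rw [sq, ← mul_assoc, Finset.mul_sum _ _ (_ * _)]
        exact Finset.sum_congr rfl fun i _ => by ring
      rw [this]
      positivity
    · refine Summable.mul_left _ (Summable.of_norm_bounded
        (((summable_succ_rpow (by linarith : -(2 * α) < -1)).mul_right
          (∑ i, |u i| * Real.sqrt 2)).mul_right (Real.sqrt 2)) fun j => ?_)
      rw [norm_mul]
      exact mul_le_mul (coef_bd α n X u j) (psi_abs_le _ _) (norm_nonneg _) (by positivity)
  have h4 : ∑ i, u i ^ 2 = 0 := by
    have h5 : 0 ≤ ∑ i, u i ^ 2 := Finset.sum_nonneg fun i _ => sq_nonneg _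
    nlinarith
  ext i
  have := (Finset.sum_eq_zero_iff_of_nonneg (fun i _ => sq_nonneg (u i))).1 h4 i (Finset.mem_univ i)
  simpa using this

lemma krr_repr_s13 (k : ℕ) (α : ℝ) (hα : (k : ℝ) + 1 / 2 < α) (n : ℕ) (hn : 0 < n) (lam : ℝ)
    (hlam : 0 < lam) (ω : Fin n → ℝ × ℝ) (f : ℕ → ℝ) (hf : Summable fun j => |f j|) :
    ∃ b : ℕ → ℝ, krrEstimator (polyKernel α) (fourierFun f) n lam ω = fourierFun b ∧
      (Summable fun j : ℕ => ((j : ℝ) + 1) ^ k * |b j|) ∧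
      (Summable fun j : ℕ => ((j : ℝ) + 1) ^ (2 * α) * b j ^ 2) ∧
      ∀ j : ℕ, lam * ((j : ℝ) + 1) ^ (2 * α) * b j = (1 / (n : ℝ)) * ∑ i, ((ω i).2 -
        ∑' l, (b l - f l) * fourierPsi (l + 1) (ω i).1) * fourierPsi (j + 1) (ω i).1 := by
  have hk0 : (0 : ℝ) ≤ k := Nat.cast_nonneg k
  have hα' : 1 / 2 < α := by linarith
  have hn' : (0 : ℝ) < n := by exact_mod_cast hn
  set M := (Matrix.of fun (i j : Fin n) => polyKernel α (ω i).1 (ω j).1) +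
        ((n : ℝ) * lam) • (1 : Matrix (Fin n) (Fin n) ℝ) with hM
  set Y : Fin n → ℝ := fun j => fourierFun f (ω j).1 + (ω j).2 with hY
  set u := M⁻¹ *ᵥ Y with hu
  have hunit : IsUnit M := kernel_isUnit α hα' n (fun i => (ω i).1) _ (by positivity)
  have hMu : M *ᵥ u = Y := by
    rw [hu, Matrix.mulVec_mulVec, Matrix.mul_nonsing_inv _ ((Matrix.isUnit_iff_isUnit_det _).1 hunit),
      Matrix.one_mulVec]
  set b : ℕ → ℝ := fun j => ((j : ℝ) + 1) ^ (-(2 * α)) *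
    ∑ i, u i * fourierPsi (j + 1) (ω i).1 with hb
  have hbd := coef_bd α n (fun i => (ω i).1) u
  set B := ∑ i, |u i| * Real.sqrt 2 with hB
  have hB0 : 0 ≤ B := by positivity
  have hkr : ∀ x, ∑ i, u i * polyKernel α x (ω i).1 = fourierFun b x := fun x =>
    polyKernel_sum α hα' n (fun i => (ω i).1) u x
  have hbs : Summable fun j : ℕ => ((j : ℝ) + 1) ^ k * |b j| := by
    refine Summable.of_nonneg_of_le (fun j => by positivity) (fun j => ?_)
      ((summable_succ_rpow (by linarith : (k : ℝ) + -(2 * α) < -1)).mul_right B)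
    rw [Real.rpow_add (by positivity), Real.rpow_natCast, mul_assoc]
    gcongr
    exact hbd j
  have hbabs : Summable fun j => |b j| := by
    refine Summable.of_nonneg_of_le (fun j => by positivity) (fun j => hbd j)
      ((summable_succ_rpow (by linarith : -(2 * α) < -1)).mul_right B)
  have hsumpsi : ∀ (c : ℕ → ℝ), (Summable fun j => |c j|) → ∀ x,
      Summable fun j => c j * fourierPsi (j + 1) x := by
    intro c hc x
    refine Summable.of_norm_bounded (hc.mul_right (Real.sqrt 2)) fun j => ?_
    rw [norm_mul]
    exact mul_le_mul_of_nonneg_left (psi_abs_le _ _) (norm_nonneg _)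
  refine ⟨b, ?_, hbs, ?_, ?_⟩
  · ext x
    rw [← hkr x]
    rfl
  · refine Summable.of_nonneg_of_le (fun j => by positivity) (fun j => ?_)
      ((summable_succ_rpow (by linarith : -(2 * α) < -1)).mul_right (B ^ 2))
    have h1 : b j ^ 2 ≤ (((j : ℝ) + 1) ^ (-(2 * α)) * B) ^ 2 := by
      rw [← sq_abs]
      gcongr
      exact hbd j
    calc _ ≤ ((j : ℝ) + 1) ^ (2 * α) * (((j : ℝ) + 1) ^ (-(2 * α)) * B) ^ 2 := by gcongr
      _ = (((j : ℝ) + 1) ^ (2 * α) * ((j : ℝ) + 1) ^ (-(2 * α))) *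
          (((j : ℝ) + 1) ^ (-(2 * α)) * B ^ 2) := by ring
      _ = _ := by
        rw [← Real.rpow_add (by positivity), add_neg_cancel, Real.rpow_zero, one_mul]
  · intro j
    have h1 : ∀ i, ∑' l, (b l - f l) * fourierPsi (l + 1) (ω i).1 =
        fourierFun b (ω i).1 - fourierFun f (ω i).1 := by
      intro i
      unfold fourierFun
      rw [← (hsumpsi b hbabs _).tsum_sub (hsumpsi f hf _)]
      exact tsum_congr fun l => by ring
    have h2 : ∀ i, fourierFun b (ω i).1 + n * lam * u i = fourierFun f (ω i).1 + (ω i).2 := by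
      intro i
      have h3 := congrFun hMu i
      rw [hM, Matrix.add_mulVec, Matrix.smul_mulVec, Matrix.one_mulVec] at h3
      simp only [Pi.add_apply, Pi.smul_apply, smul_eq_mul, Matrix.mulVec, dotProduct,
        Matrix.of_apply] at h3
      rw [← hkr]
      change _ = Y i
      rw [← h3]
      congr 1
      exact Finset.sum_congr rfl fun l _ => by ring
    have h4 : ∀ i, ((ω i).2 - ∑' l, (b l - f l) * fourierPsi (l + 1) (ω i).1) *
        fourierPsi (j + 1) (ω i).1 = n * lam * (u i * fourierPsi (j + 1) (ω i).1) := by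
      intro i
      rw [h1]
      linear_combination (-fourierPsi (j + 1) (ω i).1) * h2 i
    simp_rw [h4]
    rw [← Finset.mul_sum, hb]
    have h5 : ((j : ℝ) + 1) ^ (2 * α) * ((j : ℝ) + 1) ^ (-(2 * α)) = 1 := by
      rw [← Real.rpow_add (by positivity), add_neg_cancel, Real.rpow_zero]
    set S := ∑ i, u i * fourierPsi (j + 1) (ω i).1
    have h6 : 1 / (n : ℝ) * (n * lam * S) = lam * S := by field_simp
    rw [h6]
    linear_combination lam * S * h5

lemma eff_dim (α : ℝ) (hα : 1 / 2 < α) : ∃ C : ℝ, 0 < C ∧ ∀ h : ℝ, 0 < h → h ≤ 1 →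
    (Summable fun j : ℕ => (1 + h ^ (2 * α) * ((j : ℝ) + 1) ^ (2 * α))⁻¹) ∧
    ∑' j : ℕ, (1 + h ^ (2 * α) * ((j : ℝ) + 1) ^ (2 * α))⁻¹ ≤ C / h := by
  set F : ℕ → ℝ := fun q => (1 + (q : ℝ) ^ (2 * α))⁻¹ with hF
  have hF0 : ∀ q, 0 < F q := fun q => by positivity
  have hFs : Summable F := by
    rw [← summable_nat_add_iff 1]
    refine Summable.of_nonneg_of_le (fun q => (hF0 _).le) (fun q => ?_)
      (summable_succ_rpow (by linarith : -(2 * α) < -1))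
    simp only [hF]
    rw [Real.rpow_neg (by positivity)]
    push_cast
    apply inv_anti₀ (by positivity)
    linarith
  have hC : 0 < ∑' q, F q := hFs.tsum_pos (fun q => (hF0 q).le) 0 (hF0 0)
  refine ⟨2 * ∑' q, F q, by positivity, fun h hh h1 => ?_⟩
  set M := ⌈1 / h⌉₊ with hM
  have hM1 : 1 / h ≤ M := Nat.le_ceil _
  have hM2 : (M : ℝ) ≤ 2 / h := by
    have h2 := (Nat.ceil_lt_add_one (by positivity : 0 ≤ 1 / h)).le
    have h3 : 1 ≤ 1 / h := by rw [le_div_iff₀ hh]; linarith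
    have : 2 / h = 1 / h + 1 / h := by ring
    linarith
  have hM0 : 0 < M := by
    rw [hM, Nat.ceil_pos]; positivity
  have : NeZero M := ⟨hM0.ne'⟩
  have hone : Summable fun _ : Fin M => (1 : ℝ) := (hasSum_fintype _).summable
  have hprod : Summable fun p : ℕ × Fin M => F p.1 * (1 : ℝ) :=
    hFs.mul_of_nonneg hone (fun q => (hF0 q).le) (fun _ => zero_le_one)
  have hps : ∑' p : ℕ × Fin M, F p.1 * (1 : ℝ) = (∑' q, F q) * M := by
    rw [← hFs.tsum_mul_tsum hone hprod]; simp
  have hs := (Nat.divModEquiv M).summable_iff.2 hprod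
  have ht := (Nat.divModEquiv M).tsum_eq (fun p : ℕ × Fin M => F p.1 * (1 : ℝ))
  rw [hps] at ht
  have hle : ∀ j : ℕ, (1 + h ^ (2 * α) * ((j : ℝ) + 1) ^ (2 * α))⁻¹ ≤
      F ((Nat.divModEquiv M j).1) * 1 := by
    intro j
    have : (Nat.divModEquiv M j).1 = j / M := rfl
    rw [this, mul_one]
    simp only [hF]
    apply inv_anti₀ (by positivity)
    rw [← Real.mul_rpow hh.le (by positivity)]
    gcongr
    have h2 : ((j / M : ℕ) : ℝ) * M ≤ j := by exact_mod_cast Nat.div_mul_le_self j M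
    have h3 : (1 : ℝ) ≤ h * M := by
      rw [div_le_iff₀ hh] at hM1; linarith
    have h4 : (0 : ℝ) ≤ ((j / M : ℕ) : ℝ) := Nat.cast_nonneg _
    nlinarith
  have hsum : Summable fun j : ℕ => (1 + h ^ (2 * α) * ((j : ℝ) + 1) ^ (2 * α))⁻¹ :=
    Summable.of_nonneg_of_le (fun j => by positivity) hle hs
  refine ⟨hsum, (hsum.tsum_le_tsum hle hs).trans ?_⟩
  refine (le_of_eq ht).trans ?_
  calc _ ≤ (∑' q, F q) * (2 / h) := by gcongr
    _ = _ := by ring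

lemma summable_w_sq {ι : Type*} (w z : ι → ℝ) (hw : ∀ a, 0 ≤ w a) (hs : Summable w) (B : ℝ)
    (hz : ∀ a, |z a| ≤ B) : Summable fun a => w a * z a ^ 2 := by
  refine Summable.of_nonneg_of_le (fun a => mul_nonneg (hw a) (sq_nonneg _)) (fun a => ?_)
    (hs.mul_right (B ^ 2))
  refine mul_le_mul_of_nonneg_left ?_ (hw a)
  rw [← sq_abs]
  exact pow_le_pow_left₀ (abs_nonneg _) (hz a) 2

lemma mean_abs_le (n : ℕ) (z y : Fin n → ℝ) (h : ∀ i, |z i| ≤ y i) :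
    |(1 / (n : ℝ)) * ∑ i, z i| ≤ (1 / (n : ℝ)) * ∑ i, y i := by
  rw [abs_mul, abs_of_nonneg (by positivity : 0 ≤ 1 / (n : ℝ))]
  gcongr
  exact (Finset.abs_sum_le_sum_abs _ _).trans (Finset.sum_le_sum fun i _ => h i)

lemma psi_continuous (j : ℕ) : Continuous (fourierPsi (j + 1)) := by
  have : fourierPsi (j + 1) = dpsi 0 j := funext fun x => psi_eq j x
  rw [this]; exact dpsi_continuous 0 j

lemma psi_orth (i j : ℕ) : ∫ x in (0 : ℝ)..1, fourierPsi (i + 1) x * fourierPsi (j + 1) x =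
    if i = j then 1 else 0 := by
  simp_rw [psi_eq]; rw [dpsi_orth]; simp

lemma psi_mul_abs_le (i j : ℕ) (x : ℝ) : |fourierPsi (i + 1) x * fourierPsi (j + 1) x| ≤ 2 := by
  rw [abs_mul, ← Real.mul_self_sqrt (by norm_num : (0 : ℝ) ≤ 2)]
  exact mul_le_mul (psi_abs_le _ _) (psi_abs_le _ _) (abs_nonneg _) (Real.sqrt_nonneg _)

/-- concentration of the noise term -/
lemma noise_conc (σ : ℝ) (hσ : 0 < σ) (n : ℕ) (hn : 0 < n) (v : ℕ → ℝ) (hv0 : ∀ j, 0 ≤ v j)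
    (hvs : Summable v) (W L : ℝ) (hW : ∑' j, v j ≤ W) (hW0 : 0 < W) (hL : 0 ≤ L) :
    regressionData σ n {ω | W * (L + 1) ≤ (n / (8 * σ ^ 2)) *
      ∑' j, v j * ((1 / (n : ℝ)) * ∑ i, (ω i).2 * fourierPsi (j + 1) (ω i).1) ^ 2} ≤
      gK * ENNReal.ofReal (Real.exp (-L)) := by
  refine conc (regressionData σ n) v
    (fun j ω => (1 / (n : ℝ)) * ∑ i, (ω i).2 * fourierPsi (j + 1) (ω i).1) W _ L gK hv0 hvs hW hW0 hL
    ?_ ?_ ?_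
  · intro j
    have := (psi_continuous j).measurable
    fun_prop
  · intro j
    have h1 := noise_subG σ (fourierPsi (j + 1)) (psi_continuous j).measurable (fun x => by
      rw [sq]; exact (le_abs_self _).trans (psi_mul_abs_le j j x))
    have h2 := mean_sq σ n hn _ (by have := (psi_continuous j).measurable; fun_prop) _
      (by rw [Real.toNNReal_pos]; positivity) h1
    rw [Real.coe_toNNReal _ (by positivity)] at h2
    have e : 4 * (2 * σ ^ 2) = 8 * σ ^ 2 := by ring
    rw [e] at h2
    exact h2
  · intro ω
    exact summable_w_sq v _ hv0 hvs _ fun j => mean_abs_le n _ (fun i => |(ω i).2| * Real.sqrt 2)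
      fun i => by rw [abs_mul]; gcongr; exact psi_abs_le _ _

/-- concentration of the Gram operator -/
lemma gram_conc (σ : ℝ) (n : ℕ) (hn : 0 < n) (v : ℕ → ℝ) (hv0 : ∀ j, 0 ≤ v j)
    (hvs : Summable v) (W L : ℝ) (hW : ∑' j, v j ≤ W) (hW0 : 0 < W) (hL : 0 ≤ L) :
    regressionData σ n {ω | W ^ 2 * (L + 1) ≤ (n / 16) *
      ∑' q : ℕ × ℕ, v q.1 * v q.2 * ((1 / (n : ℝ)) * ∑ i, (fourierPsi (q.1 + 1) (ω i).1 *
        fourierPsi (q.2 + 1) (ω i).1 - (if q.1 = q.2 then 1 else 0))) ^ 2} ≤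
      gK * ENNReal.ofReal (Real.exp (-L)) := by
  have hvv : Summable fun q : ℕ × ℕ => v q.1 * v q.2 := hvs.mul_of_nonneg hvs hv0 hv0
  have hvv0 : ∀ q : ℕ × ℕ, 0 ≤ v q.1 * v q.2 := fun q => mul_nonneg (hv0 _) (hv0 _)
  refine conc (regressionData σ n) (fun q : ℕ × ℕ => v q.1 * v q.2)
    (fun q ω => (1 / (n : ℝ)) * ∑ i, (fourierPsi (q.1 + 1) (ω i).1 *
        fourierPsi (q.2 + 1) (ω i).1 - (if q.1 = q.2 then 1 else 0))) (W ^ 2) _ L gK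
    hvv0 hvv ?_ (by positivity) hL ?_ ?_ ?_
  · rw [← hvs.tsum_mul_tsum hvs hvv, sq]
    exact mul_le_mul hW hW (tsum_nonneg hv0) hW0.le
  · intro q
    have := (psi_continuous q.1).measurable
    have := (psi_continuous q.2).measurable
    fun_prop
  · intro q
    have c1 := (psi_continuous q.1)
    have c2 := (psi_continuous q.2)
    have h1 := design_subG σ (fun x => fourierPsi (q.1 + 1) x * fourierPsi (q.2 + 1) x) (by fun_prop)
      (fun x => psi_mul_abs_le _ _ x) _ (psi_orth q.1 q.2)
    have m1 := c1.measurable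
    have m2 := c2.measurable
    have h2 := mean_sq σ n hn _ (by fun_prop) 4 (by norm_num) h1
    have e : (4 : ℝ) * ((4 : ℝ≥0) : ℝ) = 16 := by norm_num
    rw [e] at h2
    exact h2
  · intro ω
    refine summable_w_sq _ _ hvv0 hvv _ fun j => mean_abs_le n _ (fun i => 3) fun i => ?_
    have h1 := psi_mul_abs_le j.1 j.2 (ω i).1
    have h2 : |(if j.1 = j.2 then (1 : ℝ) else 0)| ≤ 1 := by split_ifs <;> simp
    refine (abs_sub _ _).trans ?_
    linarith

/-- deterministic part: on the good event the derivative error is controlled -/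
lemma det_bound (k : ℕ) (α : ℝ) (hα : (k : ℝ) + 1 / 2 < α) (f : ℕ → ℝ)
    (hf : Summable fun i : ℕ => ((i : ℝ) + 1) ^ α * |f i|) (n : ℕ) (hn : 0 < n)
    (h : ℝ) (hh : 0 < h) (v : ℕ → ℝ)
    (hv : ∀ j : ℕ, v j = (1 + h ^ (2 * α) * ((j : ℝ) + 1) ^ (2 * α))⁻¹) (hvs : Summable v)
    (ω : Fin n → ℝ × ℝ) (T : ℝ)
    (hHS : ∑' q : ℕ × ℕ, v q.1 * v q.2 * ((1 / (n : ℝ)) * ∑ i, (fourierPsi (q.1 + 1) (ω i).1 *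
        fourierPsi (q.2 + 1) (ω i).1 - (if q.1 = q.2 then 1 else 0))) ^ 2 ≤ 1 / 4)
    (hN : ∑' j, v j * ((1 / (n : ℝ)) * ∑ i, (ω i).2 * fourierPsi (j + 1) (ω i).1) ^ 2 ≤
      T * h ^ (2 * α)) :
    ∫ x in (0 : ℝ)..1, (iteratedDeriv k (krrEstimator (polyKernel α) (fourierFun f) n
      (h ^ (2 * α)) ω) x - iteratedDeriv k (fourierFun f) x) ^ 2 ≤
      (Real.pi ^ k * h ^ (α - k)) ^ 2 *
        (8 * (∑' j : ℕ, ((j : ℝ) + 1) ^ (2 * α) * f j ^ 2 + T)) := by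
  have hk0 : (0 : ℝ) ≤ k := Nat.cast_nonneg k
  have hj1 : ∀ j : ℕ, (1 : ℝ) ≤ (j : ℝ) + 1 := fun j => by linarith [Nat.cast_nonneg (α := ℝ) j]
  have hfk : Summable fun j : ℕ => ((j : ℝ) + 1) ^ k * |f j| := by
    refine Summable.of_nonneg_of_le (fun j => by positivity) (fun j => ?_) hf
    rw [← Real.rpow_natCast]
    gcongr
    · exact hj1 j
    · linarith
  have hf1 : Summable fun j => |f j| := by
    refine Summable.of_nonneg_of_le (fun j => by positivity) (fun j => ?_) hfk
    have := one_le_pow₀ (hj1 j) (n := k)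
    nlinarith [abs_nonneg (f j)]
  have hf2 : Summable fun j : ℕ => ((j : ℝ) + 1) ^ (2 * α) * f j ^ 2 := by
    have h1 := hf.mul_of_nonneg hf (fun j => by positivity) (fun j => by positivity)
    have h2 := h1.comp_injective (i := fun j : ℕ => (j, j)) (fun a b h => by simpa using h)
    refine h2.congr fun j => ?_
    simp only [Function.comp]
    rw [← sq_abs, two_mul, Real.rpow_add (by positivity)]
    ring
  obtain ⟨b, hb1, hb2, hb3, hb4⟩ := krr_repr_s13 k α hα n hn (h ^ (2 * α)) (by positivity) ω f hf1
  have hgk : Summable fun j : ℕ => ((j : ℝ) + 1) ^ k * |b j - f j| := by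
    refine Summable.of_nonneg_of_le (fun j => by positivity) (fun j => ?_) (hb2.add hfk)
    rw [← mul_add]
    gcongr
    exact abs_sub _ _
  have hg1 : Summable fun j : ℕ => |b j - f j| := by
    refine Summable.of_nonneg_of_le (fun j => by positivity) (fun j => ?_) hgk
    have := one_le_pow₀ (hj1 j) (n := k)
    nlinarith [abs_nonneg (b j - f j)]
  obtain ⟨hs, hG⟩ := seq_ineq n hn (h ^ (2 * α)) (by positivity) (fun j => ((j : ℝ) + 1) ^ (2 * α))
    (fun j => Real.one_le_rpow (hj1 j) (by linarith)) (fun j i => fourierPsi (j + 1) (ω i).1)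
    (fun j i => psi_abs_le _ _) (fun i => (ω i).2) f b (fun j => b j - f j) (fun j => rfl) hg1 hf2 hb3
    v hv hvs hb4 hHS
  rw [hb1, iteratedDeriv_fourierFun k b hb2, iteratedDeriv_fourierFun k f hfk]
  have hsd : ∀ (c : ℕ → ℝ), (Summable fun j : ℕ => ((j : ℝ) + 1) ^ k * |c j|) → ∀ x,
      Summable fun j => c j * dpsi k j x := by
    intro c hc x
    refine Summable.of_norm_bounded (hc.mul_left (Real.sqrt 2 * Real.pi ^ k)) fun j => ?_
    rw [Real.norm_eq_abs, abs_mul]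
    calc _ ≤ |c j| * (Real.sqrt 2 * Real.pi ^ k * ((j : ℝ) + 1) ^ k) := by
          gcongr; exact dpsi_abs_le' k j x
      _ = _ := by ring
  have e : ∀ x, (∑' j, b j * dpsi k j x) - ∑' j, f j * dpsi k j x =
      ∑' j, (b j - f j) * dpsi k j x := by
    intro x
    rw [← (hsd b hb2 x).tsum_sub (hsd f hfk x)]
    exact tsum_congr fun j => by ring
  simp only [e]
  have hP := parseval k (fun j => b j - f j) hgk
  have hterm : ∀ j : ℕ, (b j - f j) ^ 2 * frq j ^ (2 * k) ≤ (Real.pi ^ (2 * k) * h ^ (-(2 * k : ℝ))) *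
      ((1 + h ^ (2 * α) * ((j : ℝ) + 1) ^ (2 * α)) * (b j - f j) ^ 2) := by
    intro j
    have h1 : frq j ^ (2 * k) ≤ Real.pi ^ (2 * k) * ((j : ℝ) + 1) ^ (2 * k) := by
      rw [← mul_pow]
      exact pow_le_pow_left₀ (frq_nonneg j) (frq_le j) _
    have h2 : ((j : ℝ) + 1) ^ (2 * k) ≤ h ^ (-(2 * k : ℝ)) *
        (1 + h ^ (2 * α) * ((j : ℝ) + 1) ^ (2 * α)) := by
      have hjp : 0 < (j : ℝ) + 1 := by positivity
      have h3 : ((j : ℝ) + 1) ^ (2 * k) = h ^ (-(2 * k : ℝ)) * (h * ((j : ℝ) + 1)) ^ (2 * k : ℝ) := by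
        rw [Real.mul_rpow hh.le hjp.le, ← mul_assoc, ← Real.rpow_add hh, neg_add_cancel,
          Real.rpow_zero, one_mul, ← Real.rpow_natCast]
        push_cast; rfl
      rw [h3, ← Real.mul_rpow hh.le hjp.le]
      gcongr
      set y := h * ((j : ℝ) + 1)
      have hy : 0 < y := by positivity
      rcases le_total y 1 with hy1 | hy1
      · have := Real.rpow_le_one hy.le hy1 (by positivity : (0 : ℝ) ≤ 2 * k)
        have := Real.rpow_nonneg hy.le (2 * α)
        linarith
      · have := Real.rpow_le_rpow_of_exponent_le hy1 (by linarith : (2 * k : ℝ) ≤ 2 * α)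
        linarith
    calc _ ≤ (b j - f j) ^ 2 * (Real.pi ^ (2 * k) * (h ^ (-(2 * k : ℝ)) *
        (1 + h ^ (2 * α) * ((j : ℝ) + 1) ^ (2 * α)))) := by
          gcongr
          exact h1.trans (by gcongr)
      _ = _ := by ring
  have hle := hasSum_le hterm hP (hs.hasSum.mul_left _)
  refine hle.trans ?_
  have hpw : h ^ (-(2 * k : ℝ)) * h ^ (2 * α) = (h ^ (α - k)) ^ 2 := by
    rw [← Real.rpow_add hh, ← Real.rpow_natCast, ← Real.rpow_mul hh.le]
    congr 1; push_cast; ring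
  calc _ ≤ (Real.pi ^ (2 * k) * h ^ (-(2 * k : ℝ))) * (8 * (h ^ (2 * α) *
        ∑' j : ℕ, ((j : ℝ) + 1) ^ (2 * α) * f j ^ 2 + T * h ^ (2 * α))) := by
        gcongr
        exact hG.trans (by gcongr)
    _ = Real.pi ^ (2 * k) * (h ^ (-(2 * k : ℝ)) * h ^ (2 * α)) *
        (8 * (∑' j : ℕ, ((j : ℝ) + 1) ^ (2 * α) * f j ^ 2 + T)) := by ring
    _ = _ := by rw [hpw, mul_pow, ← pow_mul, mul_comm 2 k]

/-- For `k ∈ ℕ₀`, `α > k + 1/2`, `σ > 0` and `f₀ ∈ H^α[0,1]`, the plug-in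
estimator `f̂_n^{(k)}` with kernel `K_α` and `λ_n = (log n / n)^{2α/(2α+1)}` satisfies, for
all large `n`, with probability at least `1 − n^{-10}`,
`‖f̂_n^{(k)} − f₀^{(k)}‖_{L²[0,1]} ≤ C (log n / n)^{(α−k)/(2α+1)}`. -/
theorem krr_derivative_rate_holder (k : ℕ) (α σ : ℝ) (hα : (k : ℝ) + 1 / 2 < α)
    (hσ : 0 < σ) (f : ℕ → ℝ)
    (hf : Summable fun i : ℕ => ((i : ℝ) + 1) ^ α * |f i|) :
    ∃ C : ℝ, 0 < C ∧ ∃ N : ℕ, ∀ n : ℕ, N ≤ n →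
      1 - ((n : ENNReal) ^ 10)⁻¹ ≤
        regressionData σ n
          {ω : Fin n → ℝ × ℝ |
            Real.sqrt (∫ x in (0 : ℝ)..1,
              (iteratedDeriv k
                  (krrEstimator (polyKernel α) (fourierFun f) n
                    ((Real.log n / n) ^ (2 * α / (2 * α + 1))) ω) x -
                iteratedDeriv k (fourierFun f) x) ^ 2) ≤
            C * (Real.log n / n) ^ ((α - k) / (2 * α + 1))} := by
  have hk0 : (0 : ℝ) ≤ k := Nat.cast_nonneg k
  have hα' : 1 / 2 < α := by linarith
  obtain ⟨Cv, hCv, hdim⟩ := eff_dim α hα'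
  set R2 := ∑' j : ℕ, ((j : ℝ) + 1) ^ (2 * α) * f j ^ 2 with hR2
  have hR20 : 0 ≤ R2 := tsum_nonneg fun j => by positivity
  set T := 96 * σ ^ 2 * Cv with hT
  have hT0 : 0 < T := by positivity
  refine ⟨Real.pi ^ k * Real.sqrt (8 * (R2 + T)), by positivity, ?_⟩
  -- asymptotics
  have hr0 : Filter.Tendsto (fun n : ℕ => Real.log n / n) Filter.atTop (nhds 0) :=
    (Real.isLittleO_log_id_atTop.tendsto_div_nhds_zero).comp tendsto_natCast_atTop_atTop
  have hexp : 0 < 1 - 2 / (2 * α + 1) := by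
    rw [sub_pos, div_lt_one (by linarith)]; linarith
  have hr1 : Filter.Tendsto (fun n : ℕ => 192 * Cv ^ 2 * (Real.log n / n) ^ (1 - 2 / (2 * α + 1)))
      Filter.atTop (nhds 0) := by
    have := (hr0.rpow_const (p := 1 - 2 / (2 * α + 1)) (Or.inr hexp.le)).const_mul (192 * Cv ^ 2)
    rw [Real.zero_rpow hexp.ne', mul_zero] at this
    exact this
  have hev1 : ∀ᶠ n : ℕ in Filter.atTop,
      192 * Cv ^ 2 * (Real.log n / n) ^ (1 - 2 / (2 * α + 1)) < 1 / 4 :=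
    hr1.eventually_lt_const (by norm_num)
  have hev2 : ∀ᶠ n : ℕ in Filter.atTop, 2 * gK.toReal ≤ n :=
    tendsto_natCast_atTop_atTop.eventually_ge_atTop _
  have hev3 : ∀ᶠ n : ℕ in Filter.atTop, 3 ≤ n := Filter.eventually_ge_atTop 3
  obtain ⟨N, hN⟩ := Filter.eventually_atTop.1 (hev1.and (hev2.and hev3))
  refine ⟨N, fun n hn => ?_⟩
  obtain ⟨hn1, hn2, hn3⟩ := hN n hn
  have hnpos : 0 < n := by omega
  have hnR : (0 : ℝ) < n := by exact_mod_cast hnpos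
  have hlog1 : 1 ≤ Real.log n := by
    rw [Real.le_log_iff_exp_le hnR]
    have : (3 : ℝ) ≤ n := by exact_mod_cast hn3
    linarith [Real.exp_one_lt_d9]
  set r := Real.log n / n with hr
  have hrpos : 0 < r := by positivity
  have hrle : r ≤ 1 := by
    rw [hr, div_le_one hnR]
    linarith [Real.log_le_sub_one_of_pos hnR]
  set h := r ^ (1 / (2 * α + 1)) with hh
  have hhpos : 0 < h := by positivity
  have hhle : h ≤ 1 := Real.rpow_le_one hrpos.le hrle (by
    apply div_nonneg zero_le_one; linarith)
  have hden : (2 * α + 1) ≠ 0 := by linarith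
  have hlam : r ^ (2 * α / (2 * α + 1)) = h ^ (2 * α) := by
    rw [hh, ← Real.rpow_mul hrpos.le]; congr 1; ring
  have hrate : r ^ ((α - k) / (2 * α + 1)) = h ^ (α - k) := by
    rw [hh, ← Real.rpow_mul hrpos.le]; congr 1; ring
  have hrh : r = h ^ (2 * α) * h := by
    have e1 : h ^ (2 * α) * h = h ^ (2 * α + 1) := by
      rw [Real.rpow_add hhpos, Real.rpow_one]
    rw [e1, hh, ← Real.rpow_mul hrpos.le, one_div, inv_mul_cancel₀ hden, Real.rpow_one]
  have hrh2 : r / h ^ 2 = r ^ (1 - 2 / (2 * α + 1)) := by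
    rw [Real.rpow_sub hrpos, Real.rpow_one, hh, ← Real.rpow_natCast, ← Real.rpow_mul hrpos.le]
    congr 2; push_cast; ring
  obtain ⟨hvs, hvW⟩ := hdim h hhpos hhle
  set v : ℕ → ℝ := fun j => (1 + h ^ (2 * α) * ((j : ℝ) + 1) ^ (2 * α))⁻¹ with hv
  have hv0 : ∀ j, 0 ≤ v j := fun j => by positivity
  have hWpos : 0 < Cv / h := by positivity
  have hL0 : 0 ≤ 11 * Real.log n := by positivity
  have hA := noise_conc σ hσ n hnpos v hv0 hvs (Cv / h) (11 * Real.log n) hvW hWpos hL0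
  have hB := gram_conc σ n hnpos v hv0 hvs (Cv / h) (11 * Real.log n) hvW hWpos hL0
  rw [hlam, hrate]
  set bad1 := {ω : Fin n → ℝ × ℝ | Cv / h * (11 * Real.log n + 1) ≤ (n / (8 * σ ^ 2)) *
      ∑' j, v j * ((1 / (n : ℝ)) * ∑ i, (ω i).2 * fourierPsi (j + 1) (ω i).1) ^ 2} with hbad1
  set bad2 := {ω : Fin n → ℝ × ℝ | (Cv / h) ^ 2 * (11 * Real.log n + 1) ≤ (n / 16) *
      ∑' q : ℕ × ℕ, v q.1 * v q.2 * ((1 / (n : ℝ)) * ∑ i, (fourierPsi (q.1 + 1) (ω i).1 *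
        fourierPsi (q.2 + 1) (ω i).1 - (if q.1 = q.2 then 1 else 0))) ^ 2} with hbad2
  set S := {ω : Fin n → ℝ × ℝ | Real.sqrt (∫ x in (0 : ℝ)..1,
      (iteratedDeriv k (krrEstimator (polyKernel α) (fourierFun f) n (h ^ (2 * α)) ω) x -
        iteratedDeriv k (fourierFun f) x) ^ 2) ≤
      Real.pi ^ k * Real.sqrt (8 * (R2 + T)) * h ^ (α - k)} with hS
  have hcover : Set.univ ⊆ S ∪ (bad1 ∪ bad2) := by
    intro ω _
    by_cases h1 : ω ∈ bad1
    · exact Or.inr (Or.inl h1)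
    by_cases h2 : ω ∈ bad2
    · exact Or.inr (Or.inr h2)
    refine Or.inl ?_
    have h1' := h1
    rw [hbad1, Set.mem_ofPred_eq, not_le] at h1'
    have h2' := h2
    rw [hbad2, Set.mem_ofPred_eq, not_le] at h2'
    have hL : 11 * Real.log n + 1 ≤ 12 * Real.log n := by linarith
    have hrn : Real.log n = r * n := by rw [hr]; field_simp
    have hnoise : ∑' j, v j * ((1 / (n : ℝ)) * ∑ i, (ω i).2 * fourierPsi (j + 1) (ω i).1) ^ 2 ≤
        T * h ^ (2 * α) := by
      have h3 := h1'.le.trans (mul_le_mul_of_nonneg_left hL hWpos.le)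
      rw [hrn, div_mul_eq_mul_div, div_le_iff₀ (by positivity)] at h3
      refine le_of_mul_le_mul_left (h3.trans (le_of_eq ?_)) hnR
      rw [hrh, hT]
      field_simp
      ring
    have hHS : ∑' q : ℕ × ℕ, v q.1 * v q.2 * ((1 / (n : ℝ)) * ∑ i, (fourierPsi (q.1 + 1) (ω i).1 *
        fourierPsi (q.2 + 1) (ω i).1 - (if q.1 = q.2 then 1 else 0))) ^ 2 ≤ 1 / 4 := by
      have h3 := h2'.le.trans (mul_le_mul_of_nonneg_left hL (by positivity))
      rw [hrn, div_mul_eq_mul_div, div_le_iff₀ (by positivity)] at h3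
      refine le_trans ?_ hn1.le
      rw [← hrh2]
      refine le_of_mul_le_mul_left (h3.trans (le_of_eq ?_)) hnR
      field_simp
      ring
    have hdet := det_bound k α hα f hf n hnpos h hhpos v (fun j => rfl) hvs ω T hHS hnoise
    rw [hS, Set.mem_ofPred_eq]
    refine (Real.sqrt_le_sqrt hdet).trans (le_of_eq ?_)
    rw [Real.sqrt_mul (by positivity), Real.sqrt_sq (by positivity)]
    ring
  have hmeas : (1 : ENNReal) ≤ regressionData σ n S +
      (gK * ENNReal.ofReal (Real.exp (-(11 * Real.log n))) +
       gK * ENNReal.ofReal (Real.exp (-(11 * Real.log n)))) := by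
    calc (1 : ENNReal) = regressionData σ n Set.univ := measure_univ.symm
      _ ≤ regressionData σ n (S ∪ (bad1 ∪ bad2)) := measure_mono hcover
      _ ≤ regressionData σ n S + regressionData σ n (bad1 ∪ bad2) := measure_union_le _ _
      _ ≤ _ := by
        gcongr
        exact (measure_union_le _ _).trans (add_le_add hA hB)
  rw [tsub_le_iff_right]
  refine hmeas.trans ?_
  gcongr
  have hexpn : Real.exp (-(11 * Real.log n)) = ((n : ℝ) ^ 11)⁻¹ := by
    rw [Real.exp_neg, mul_comm, Real.exp_mul, Real.exp_log hnR]
    norm_cast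
  have hgK : gK = ENNReal.ofReal gK.toReal := (ENNReal.ofReal_toReal gK_lt_top.ne).symm
  have hrhs : ((n : ENNReal) ^ 10)⁻¹ = ENNReal.ofReal (((n : ℝ) ^ 10)⁻¹) := by
    rw [ENNReal.ofReal_inv_of_pos (by positivity), ENNReal.ofReal_pow hnR.le, ENNReal.ofReal_natCast]
  rw [hexpn, hgK, hrhs, ← ENNReal.ofReal_mul ENNReal.toReal_nonneg,
    ← ENNReal.ofReal_add (by positivity) (by positivity)]
  apply ENNReal.ofReal_le_ofReal
  calc _ = 2 * gK.toReal * ((n : ℝ) ^ 11)⁻¹ := by ring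
    _ ≤ n * ((n : ℝ) ^ 11)⁻¹ := by gcongr
    _ = _ := by field_simp
end
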